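/- arXiv:1003.3825 — 3 statements merged into one kernel-verified Lean document; each statement's English description precedes it below -/
import Mathlib

section
/- For a positive integer t, let P(t) denote the number of pure O-sequences of socle degree 3 and type t, i.e., the number of sequences (1, r, a, t) with r, a positive integers that are pure O-sequences (note that a pure order ideal of socle degree 3 has type equal to h_3). Then lim_{t→∞} P(t)/t² = 9/2. -/
/-- The degree of a monomial, given by its exponent vector. -/
def monDeg {r : ℕ} (M : Fin r → ℕ) : ℕ := ∑ j, M j

/-- `X` is a (monomial) order ideal: a nonempty finite set of monomials (exponent vectors)
closed under divisibility. -/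
def IsOrderIdeal {r : ℕ} (X : Finset (Fin r → ℕ)) : Prop :=
  X.Nonempty ∧ ∀ M ∈ X, ∀ N : Fin r → ℕ, (∀ j, N j ≤ M j) → N ∈ X

/-- `M` is a maximal monomial of `X` with respect to divisibility. -/
def IsMaxMon {r : ℕ} (X : Finset (Fin r → ℕ)) (M : Fin r → ℕ) : Prop :=
  M ∈ X ∧ ∀ N ∈ X, (∀ j, M j ≤ N j) → N = M

/-- `X` is a pure order ideal with socle degree `e`: it is an order ideal whose maximal
degree is `e` and all of whose maximal monomials have degree `e`. -/
def IsPureWithSocle {r : ℕ} (X : Finset (Fin r → ℕ)) (e : ℕ) : Prop :=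
  IsOrderIdeal X ∧ (∀ M ∈ X, monDeg M ≤ e) ∧ (∃ M ∈ X, monDeg M = e) ∧
    ∀ M, IsMaxMon X M → monDeg M = e

/-- `h` agrees in degrees `≤ e` with the h-vector of `X`. -/
def HasHVector {r : ℕ} (X : Finset (Fin r → ℕ)) (h : ℕ → ℕ) (e : ℕ) : Prop :=
  ∀ i ≤ e, h i = (X.filter fun M => monDeg M = i).card

/-- `h` is (in degrees `≤ e`) a pure O-sequence of socle degree `e`. -/
def IsPureOSeq (h : ℕ → ℕ) (e : ℕ) : Prop :=
  ∃ (r : ℕ) (X : Finset (Fin r → ℕ)), IsPureWithSocle X e ∧ HasHVector X h e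

/-- `h` is a pure O-sequence of socle degree `e` and type `t`. -/
def IsPureOSeqOfType (h : ℕ → ℕ) (e t : ℕ) : Prop :=
  ∃ (r : ℕ) (X : Finset (Fin r → ℕ)), IsPureWithSocle X e ∧ HasHVector X h e ∧
    {M : Fin r → ℕ | IsMaxMon X M}.ncard = t

/-- `((n)_(d))_1^1`, computed from the `d`-binomial (Macaulay) expansion of `n`
obtained greedily; by convention `((0)_(d))_1^1 = 0`. -/
def macaulayBound : ℕ → ℕ → ℕ
  | 0, _ => 0
  | (n+1), d =>
      Nat.choose (Nat.findGreatest (fun k => Nat.choose k d ≤ n + 1) (n + 1 + d) + 1) (d + 1) +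
        macaulayBound
          ((n + 1) - Nat.choose (Nat.findGreatest (fun k => Nat.choose k d ≤ n + 1) (n + 1 + d)) d)
          (d - 1)
  termination_by n d => n
  decreasing_by
    have hd : d ≤ Nat.findGreatest (fun k => Nat.choose k d ≤ n + 1) (n + 1 + d) :=
      Nat.le_findGreatest (by omega) (by simp [Nat.choose_self])
    have hpos := Nat.choose_pos hd
    omega

/-- `g` satisfies Macaulay's bound (in degrees `1 ≤ i ≤ e - 1`). -/
def SatisfiesMacaulay (g : ℕ → ℕ) (e : ℕ) : Prop :=
  ∀ i, 1 ≤ i → i + 1 ≤ e → g (i + 1) ≤ macaulayBound (g i) i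

/-- `h` is an O-sequence of socle degree `e`. -/
def IsOSeq (h : ℕ → ℕ) (e : ℕ) : Prop :=
  h 0 = 1 ∧ (∀ i ≤ e, 0 < h i) ∧ SatisfiesMacaulay h e

/-- `h` is differentiable: its first difference `(1, h 1 - h 0, …, h e - h (e-1))`
consists of nonnegative integers and satisfies Macaulay's bound. -/
def IsDifferentiable (h : ℕ → ℕ) (e : ℕ) : Prop :=
  h 0 = 1 ∧ (∀ i, 1 ≤ i → i ≤ e → h (i - 1) ≤ h i) ∧
    SatisfiesMacaulay (fun i => if i = 0 then 1 else h i - h (i - 1)) e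

open Filter

/-- The sequence `(1, a, b, c)` (padded by zeros). -/
def seq4 (a b c : ℕ) : ℕ → ℕ := fun i => [1, a, b, c].getD i 0

/-- The number `P(t)` of pure O-sequences `(1, r, a, t)` of socle degree 3 (such a
sequence automatically has type `t = h₃`). -/
noncomputable def socleDeg3Count (t : ℕ) : ℕ :=
  {p : ℕ × ℕ | 0 < p.1 ∧ 0 < p.2 ∧ IsPureOSeq (seq4 p.1 p.2 t) 3}.ncard

lemma monDeg_add' {n : ℕ} (M N : Fin n → ℕ) : monDeg (M + N) = monDeg M + monDeg N := by
  simp [monDeg, Finset.sum_add_distrib]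

lemma monDeg_single' {n : ℕ} (k : Fin n) : monDeg (Pi.single k 1 : Fin n → ℕ) = 1 := by
  simp [monDeg]

lemma monDeg_zero_iff {n : ℕ} (M : Fin n → ℕ) : monDeg M = 0 ↔ M = 0 := by
  simp [monDeg, funext_iff]

lemma single_le_of_ne {n : ℕ} (M : Fin n → ℕ) (k : Fin n) (h : M k ≠ 0) :
    ∃ N : Fin n → ℕ, M = Pi.single k 1 + N := by
  refine ⟨M - Pi.single k 1, ?_⟩
  funext j
  by_cases hj : j = k
  · subst hj
    simp
    omega
  · simp [Pi.single_eq_of_ne hj]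

lemma exists_split {n d : ℕ} (M : Fin n → ℕ) (h : monDeg M = d + 1) :
    ∃ (k : Fin n) (N : Fin n → ℕ), M = Pi.single k 1 + N ∧ monDeg N = d := by
  have : ∃ k, M k ≠ 0 := by
    by_contra! hc
    have : monDeg M = 0 := by simp [monDeg, hc]
    omega
  obtain ⟨k, hk⟩ := this
  obtain ⟨N, hN⟩ := single_le_of_ne M k hk
  refine ⟨k, N, hN, ?_⟩
  have := congrArg monDeg hN
  rw [monDeg_add', monDeg_single'] at this
  omega

lemma exists_top {n : ℕ} {X : Finset (Fin n → ℕ)} (hX : IsPureWithSocle X 3)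
    {M : Fin n → ℕ} (hM : M ∈ X) : ∃ N ∈ X, M ≤ N ∧ monDeg N = 3 := by
  obtain ⟨N, hle, hN⟩ := X.exists_le_maximal hM
  refine ⟨N, hN.1, hle, hX.2.2.2 N ⟨hN.1, fun P hP h => ?_⟩⟩
  exact le_antisymm (hN.2 hP h) h

lemma h2_le {n : ℕ} {X : Finset (Fin n → ℕ)} (hX : IsPureWithSocle X 3) :
    (X.filter fun M => monDeg M = 2).card ≤ (X.filter fun M => monDeg M = 3).card * 3 := by
  classical
  have hsub : (X.filter fun M => monDeg M = 2) ⊆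
      (X.filter fun M => monDeg M = 3).biUnion
        (fun M => (Finset.univ.filter fun k => M k ≠ 0).image fun k => M - (Pi.single k 1 : Fin n → ℕ)) := by
    intro N hN
    rw [Finset.mem_filter] at hN
    obtain ⟨M, hM, hle, hd⟩ := exists_top hX hN.1
    rw [Finset.mem_biUnion]
    refine ⟨M, by simp [hM, hd], ?_⟩
    have h1 : monDeg (M - N) = 0 + 1 := by
      have : M = N + (M - N) := by
        funext j
        have : N j ≤ M j := hle j
        simp
        omega
      have h2 := congrArg monDeg this
      rw [monDeg_add'] at h2
      omega
    obtain ⟨k, P, hP, hP0⟩ := exists_split _ h1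
    rw [monDeg_zero_iff] at hP0
    subst hP0
    have hMN : M = N + Pi.single k 1 := by
      funext j
      have : N j ≤ M j := hle j
      have h3 := congrFun hP j
      simp at h3 ⊢
      omega
    rw [Finset.mem_image]
    refine ⟨k, by simp [hMN], ?_⟩
    rw [hMN]
    funext j
    simp
  refine (Finset.card_le_card hsub).trans (Finset.card_biUnion_le_card_mul _ _ _ ?_)
  intro M hM
  rw [Finset.mem_filter] at hM
  refine Finset.card_image_le.trans ?_
  rw [← hM.2, Finset.card_eq_sum_ones, Finset.sum_filter]
  unfold monDeg
  refine Finset.sum_le_sum fun k _ => ?_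
  split_ifs <;> omega

lemma h1_le {n : ℕ} {X : Finset (Fin n → ℕ)} (hX : IsPureWithSocle X 3) :
    (X.filter fun M => monDeg M = 1).card ≤ (X.filter fun M => monDeg M = 2).card := by
  classical
  set S : Finset (Fin n) := Finset.univ.filter fun k => Pi.single k 1 ∈ X with hS
  set Q := X.filter fun M => monDeg M = 2 with hQ
  have h1 : (X.filter fun M => monDeg M = 1).card ≤ S.card := by
    have : (X.filter fun M => monDeg M = 1) ⊆ S.image fun k => (Pi.single k 1 : Fin n → ℕ) := by
      intro M hM
      rw [Finset.mem_filter] at hM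
      obtain ⟨k, P, hP, hP0⟩ := exists_split (d := 0) _ hM.2
      rw [monDeg_zero_iff] at hP0
      subst hP0
      rw [add_zero] at hP
      subst hP
      exact Finset.mem_image_of_mem _ (by simp [hS, hM.1])
    exact (Finset.card_le_card this).trans Finset.card_image_le
  refine h1.trans ?_
  have hli : LinearIndependent ℚ (fun (j : S) (N : Q) => ((N : Fin n → ℕ) j : ℚ)) := by
    rw [Fintype.linearIndependent_iff]
    intro g hg j
    have key : ∀ k l : Fin n, ∀ (hk : k ∈ S) (hl : l ∈ S),
        (Pi.single k 1 + Pi.single l 1 : Fin n → ℕ) ∈ X → g ⟨k, hk⟩ + g ⟨l, hl⟩ = 0 := by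
      intro k l hk hl hX'
      have h2 : (Pi.single k 1 + Pi.single l 1 : Fin n → ℕ) ∈ Q := by
        rw [hQ, Finset.mem_filter]
        exact ⟨hX', by rw [monDeg_add', monDeg_single', monDeg_single']⟩
      have h3 := congrFun hg ⟨_, h2⟩
      have e : ∀ (k : Fin n) (hk : k ∈ S) (x : S),
          ((Pi.single k 1 : Fin n → ℕ) x : ℚ) = if x = ⟨k, hk⟩ then 1 else 0 := by
        intro k hk x
        rw [Pi.single_apply]
        have : (x : Fin n) = k ↔ x = ⟨k, hk⟩ := by rw [Subtype.ext_iff]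
        simp only [this]
        split_ifs <;> simp
      simp only [Finset.sum_apply, Pi.smul_apply, Pi.add_apply, Nat.cast_add, smul_eq_mul,
        Pi.zero_apply, e k hk, e l hl, mul_add, Finset.sum_add_distrib, mul_ite, mul_one,
        mul_zero, Finset.sum_ite_eq', Finset.mem_univ, if_true] at h3
      exact h3
    obtain ⟨j, hj⟩ := j
    have hjX : (Pi.single j 1 : Fin n → ℕ) ∈ X := by simpa [hS] using hj
    obtain ⟨M, hM, hle, hd⟩ := exists_top hX hjX
    have hj0 : M j ≠ 0 := by
      have := hle j
      simp at this
      omega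
    obtain ⟨N, hN⟩ := single_le_of_ne M j hj0
    have hNd : monDeg N = 1 + 1 := by
      have := congrArg monDeg hN
      rw [monDeg_add', monDeg_single'] at this
      omega
    obtain ⟨k, P, rfl, hP⟩ := exists_split N hNd
    obtain ⟨l, R, rfl, hR⟩ := exists_split (d := 0) P hP
    rw [monDeg_zero_iff] at hR
    subst hR
    have mem : ∀ A : Fin n → ℕ, (∀ i, A i ≤ M i) → A ∈ X := hX.1.2 M hM
    have hk : k ∈ S := by
      simp only [hS, Finset.mem_filter, Finset.mem_univ, true_and]
      apply mem
      intro i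
      rw [hN]
      simp only [Pi.add_apply]
      omega
    have hl : l ∈ S := by
      simp only [hS, Finset.mem_filter, Finset.mem_univ, true_and]
      apply mem
      intro i
      rw [hN]
      simp only [Pi.add_apply]
      omega
    have a1 := key j k hj hk (mem _ (by intro i; rw [hN]; simp only [Pi.add_apply]; omega))
    have a2 := key j l hj hl (mem _ (by intro i; rw [hN]; simp only [Pi.add_apply]; omega))
    have a3 := key k l hk hl (mem _ (by intro i; rw [hN]; simp only [Pi.add_apply]; omega))
    linarith
  have := hli.fintype_card_le_finrank
  simpa using this

lemma upper_bound {r a t : ℕ} (h : IsPureOSeq (seq4 r a t) 3) : r ≤ a ∧ a ≤ 3 * t := by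
  obtain ⟨n, X, hX, hh⟩ := h
  have e1 := hh 1 (by norm_num)
  have e2 := hh 2 (by norm_num)
  have e3 := hh 3 (by norm_num)
  have i1 := h1_le hX
  have i2 := h2_le hX
  rw [← e1, ← e2] at i1
  rw [← e2, ← e3] at i2
  simp [seq4] at i1 i2
  omega

/-- The degree `i` monomials dividing some element of `G`. -/
def shad {V : Type} [DecidableEq V] (i : ℕ) (G : Finset (Multiset V)) : Finset (Multiset V) :=
  G.biUnion fun M => (M.powersetCard i).toFinset

lemma mem_shad {V : Type} [DecidableEq V] {i : ℕ} {G : Finset (Multiset V)} {N : Multiset V} :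
    N ∈ shad i G ↔ ∃ M ∈ G, N ≤ M ∧ N.card = i := by
  simp [shad, Multiset.mem_powersetCard]

/-- `(1, r, a, t)` is the h-vector of the ideal generated by a set of `t` cubic monomials. -/
def Realz (r a t : ℕ) : Prop :=
  ∃ (V : Type) (_ : Fintype V) (_ : DecidableEq V) (G : Finset (Multiset V)),
    (∀ M ∈ G, M.card = 3) ∧ (shad 1 G).card = r ∧ (shad 2 G).card = a ∧ G.card = t

lemma Realz.zero : Realz 0 0 0 :=
  ⟨Empty, inferInstance, inferInstance, ∅, by simp, by simp [shad], by simp [shad], by simp⟩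

lemma shad_sum {V W : Type} [DecidableEq V] [DecidableEq W] (G : Finset (Multiset V))
    (H : Finset (Multiset W)) (i : ℕ) (hi : i ≠ 0) :
    (shad i (G.image (Multiset.map (Sum.inl : V → V ⊕ W)) ∪
      H.image (Multiset.map (Sum.inr : W → V ⊕ W)))).card = (shad i G).card + (shad i H).card := by
  have e : shad i (G.image (Multiset.map (Sum.inl : V → V ⊕ W)) ∪
      H.image (Multiset.map (Sum.inr : W → V ⊕ W))) =
      (shad i G).image (Multiset.map (Sum.inl : V → V ⊕ W)) ∪
      (shad i H).image (Multiset.map (Sum.inr : W → V ⊕ W)) := by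
    ext N
    simp only [shad, Finset.mem_biUnion, Finset.mem_union, Finset.mem_image,
      Multiset.mem_toFinset]
    constructor
    · rintro ⟨M, (⟨P, hP, rfl⟩ | ⟨P, hP, rfl⟩), hN⟩
      · rw [Multiset.powersetCard_map, Multiset.mem_map] at hN
        obtain ⟨Q, hQ, rfl⟩ := hN
        exact Or.inl ⟨Q, ⟨P, hP, hQ⟩, rfl⟩
      · rw [Multiset.powersetCard_map, Multiset.mem_map] at hN
        obtain ⟨Q, hQ, rfl⟩ := hN
        exact Or.inr ⟨Q, ⟨P, hP, hQ⟩, rfl⟩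
    · rintro (⟨Q, ⟨P, hP, hQ⟩, rfl⟩ | ⟨Q, ⟨P, hP, hQ⟩, rfl⟩)
      · refine ⟨_, Or.inl ⟨P, hP, rfl⟩, ?_⟩
        rw [Multiset.powersetCard_map]
        exact Multiset.mem_map_of_mem _ hQ
      · refine ⟨_, Or.inr ⟨P, hP, rfl⟩, ?_⟩
        rw [Multiset.powersetCard_map]
        exact Multiset.mem_map_of_mem _ hQ
  rw [e, Finset.card_union_of_disjoint, Finset.card_image_of_injective _
    (Multiset.map_injective Sum.inl_injective), Finset.card_image_of_injective _
    (Multiset.map_injective Sum.inr_injective)]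
  rw [Finset.disjoint_left]
  intro N h1 h2
  rw [Finset.mem_image] at h1 h2
  obtain ⟨P, hP, rfl⟩ := h1
  obtain ⟨Q, hQ, hPQ⟩ := h2
  obtain ⟨_, _, _, hc⟩ := mem_shad.1 hP
  have : ∃ x, x ∈ P := Multiset.exists_mem_of_ne_zero (by rintro rfl; simp at hc; omega)
  obtain ⟨x, hx⟩ := this
  have h3 : Sum.inl x ∈ Multiset.map (Sum.inr : W → V ⊕ W) Q := by
    rw [hPQ]; exact Multiset.mem_map_of_mem _ hx
  simp at h3

lemma shad_self {V : Type} [DecidableEq V] (i : ℕ) (G : Finset (Multiset V))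
    (h : ∀ M ∈ G, M.card = i) : shad i G = G := by
  ext N
  rw [mem_shad]
  constructor
  · rintro ⟨M, hM, hle, hc⟩
    have := Multiset.eq_of_le_of_card_le hle (by rw [hc, h M hM])
    rwa [this]
  · exact fun hN => ⟨N, hN, le_rfl, h N hN⟩

lemma Realz.add {r a t r' a' t' : ℕ} (h : Realz r a t) (h' : Realz r' a' t') :
    Realz (r + r') (a + a') (t + t') := by
  obtain ⟨V, _, _, G, hG, rfl, rfl, rfl⟩ := h
  obtain ⟨W, _, _, H, hH, rfl, rfl, rfl⟩ := h'
  have hc : ∀ M ∈ (G.image (Multiset.map (Sum.inl : V → V ⊕ W)) ∪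
      H.image (Multiset.map (Sum.inr : W → V ⊕ W))), M.card = 3 := by
    intro M hM
    rw [Finset.mem_union, Finset.mem_image, Finset.mem_image] at hM
    rcases hM with ⟨P, hP, rfl⟩ | ⟨P, hP, rfl⟩
    · simp [hG P hP]
    · simp [hH P hP]
  refine ⟨V ⊕ W, inferInstance, inferInstance, _, hc, shad_sum G H 1 (by norm_num),
    shad_sum G H 2 (by norm_num), ?_⟩
  have := shad_sum G H 3 (by norm_num)
  rwa [shad_self 3 _ hc, shad_self 3 _ hG, shad_self 3 _ hH] at this

lemma Realz.mul {r a t : ℕ} (h : Realz r a t) (j : ℕ) : Realz (j * r) (j * a) (j * t) := by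
  induction j with
  | zero => simpa using Realz.zero
  | succ j ih => simpa [Nat.succ_mul] using ih.add h

lemma realz_111 : Realz 1 1 1 :=
  ⟨Fin 1, inferInstance, inferInstance, {{0, 0, 0}}, by decide, by decide, by decide, by decide⟩

lemma realz_221 : Realz 2 2 1 :=
  ⟨Fin 2, inferInstance, inferInstance, {{0, 0, 1}}, by decide, by decide, by decide, by decide⟩

lemma realz_331 : Realz 3 3 1 :=
  ⟨Fin 3, inferInstance, inferInstance, {{0, 1, 2}}, by decide, by decide, by decide, by decide⟩

lemma realz_232 : Realz 2 3 2 :=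
  ⟨Fin 2, inferInstance, inferInstance, {{0, 0, 1}, {0, 1, 1}}, by decide, by decide, by decide,
    by decide⟩

lemma realz_lin (r : ℕ) : Realz r r ((r + 2) / 3) := by
  have h := realz_331.mul (r / 3)
  have : r % 3 = 0 ∨ r % 3 = 1 ∨ r % 3 = 2 := by omega
  rcases this with h0 | h0 | h0
  · convert h using 1 <;> omega
  · convert h.add realz_111 using 1 <;> omega
  · convert h.add realz_221 using 1 <;> omega

lemma realz_full (n s : ℕ) (h1 : n ^ 2 ≤ s) (h2 : s ≤ n.multichoose 3) :
    Realz n (n.multichoose 2) s := by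
  classical
  let B : Finset (Multiset (Fin n)) :=
    (Finset.univ : Finset (Fin n × Fin n)).image fun p => {p.1, p.1, p.2}
  let A : Finset (Multiset (Fin n)) :=
    (Finset.univ : Finset (Sym (Fin n) 3)).image Sym.toMultiset
  have hA : A.card = n.multichoose 3 := by
    rw [Finset.card_image_of_injective _ Sym.coe_injective, Finset.card_univ,
      Sym.card_sym_eq_multichoose, Fintype.card_fin]
  have hB : B.card ≤ n ^ 2 := by
    refine Finset.card_image_le.trans ?_
    simp [sq]
  have hBA : B ⊆ A := by
    intro M hM
    simp only [B, Finset.mem_image] at hM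
    obtain ⟨p, _, rfl⟩ := hM
    simp only [A, Finset.mem_image]
    exact ⟨⟨{p.1, p.1, p.2}, by simp⟩, Finset.mem_univ _, rfl⟩
  obtain ⟨G, hBG, hGA, hG⟩ := Finset.exists_subsuperset_card_eq hBA (hB.trans h1) (hA ▸ h2)
  have hcov : ∀ i j : Fin n, ({i, i, j} : Multiset (Fin n)) ∈ G := fun i j =>
    hBG (Finset.mem_image.2 ⟨(i, j), Finset.mem_univ _, rfl⟩)
  have hsh : ∀ d, (∀ N : Multiset (Fin n), N.card = d → ∃ M ∈ G, N ≤ M) →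
      (shad d G).card = n.multichoose d := by
    intro d hd
    have : shad d G = (Finset.univ : Finset (Sym (Fin n) d)).image
        Sym.toMultiset := by
      ext N
      rw [mem_shad, Finset.mem_image]
      constructor
      · rintro ⟨_, _, _, hc⟩
        exact ⟨⟨N, hc⟩, Finset.mem_univ _, rfl⟩
      · rintro ⟨⟨N, hN⟩, _, rfl⟩
        obtain ⟨M, hM, hle⟩ := hd N hN
        exact ⟨M, hM, hle, hN⟩
    rw [this, Finset.card_image_of_injective _ Sym.coe_injective, Finset.card_univ,
      Sym.card_sym_eq_multichoose, Fintype.card_fin]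
  refine ⟨Fin n, inferInstance, inferInstance, G, ?_, ?_, ?_, hG⟩
  · intro M hM
    have := hGA hM
    simp only [A, Finset.mem_image] at this
    obtain ⟨s, _, rfl⟩ := this
    exact s.2
  · rw [hsh 1, Nat.multichoose_one_right]
    intro N hN
    obtain ⟨x, rfl⟩ := Multiset.card_eq_one.1 hN
    exact ⟨_, hcov x x, by simp⟩
  · apply hsh 2
    intro N hN
    obtain ⟨x, y, rfl⟩ := Multiset.card_eq_two.1 hN
    exact ⟨_, hcov x y, by
      simp only [Multiset.insert_eq_cons]
      exact Multiset.le_cons_self _ _⟩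

/-- The Latin square cubic attached to a cell. -/
def lat {m : ℕ} (p : ZMod m × ZMod m) : Multiset (Fin 3 × ZMod m) :=
  {(0, p.1), (1, p.2), (2, p.1 + p.2)}

lemma lat_shad_card {m : ℕ} (p : ZMod m × ZMod m) :
    ((lat p).powersetCard 2).toFinset.card = 3 := by
  rw [Multiset.toFinset_card_of_nodup]
  · simp [lat, Multiset.card_powersetCard]
  · apply Multiset.Nodup.powersetCard
    simp [lat]

lemma lat_sep {m : ℕ} {p q : ZMod m × ZMod m} {N : Multiset (Fin 3 × ZMod m)}
    (hN : N.card = 2) (hp : N ≤ lat p) (hq : N ≤ lat q) : p = q := by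
  obtain ⟨⟨i, x⟩, ⟨j, y⟩, rfl⟩ := Multiset.card_eq_two.1 hN
  have hnd : ({(i, x), (j, y)} : Multiset (Fin 3 × ZMod m)).Nodup :=
    Multiset.nodup_of_le hp (by simp [lat])
  have a1 := Multiset.mem_of_le hp (show (i, x) ∈ _ by simp)
  have a2 := Multiset.mem_of_le hp (show (j, y) ∈ _ by simp)
  have b1 := Multiset.mem_of_le hq (show (i, x) ∈ _ by simp)
  have b2 := Multiset.mem_of_le hq (show (j, y) ∈ _ by simp)
  obtain ⟨p1, p2⟩ := p
  obtain ⟨q1, q2⟩ := q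
  simp only [lat, Multiset.insert_eq_cons, Multiset.mem_cons, Multiset.mem_singleton,
    Prod.mk.injEq] at a1 a2 b1 b2
  simp at hnd
  fin_cases i <;> fin_cases j <;> simp_all

lemma realz_latin (m k : ℕ) (hm : 0 < m) (hk : k ≤ m ^ 2) :
    ∃ ρ ≤ 3 * m, Realz ρ (3 * k) k := by
  classical
  have : NeZero m := ⟨hm.ne'⟩
  obtain ⟨S, hS⟩ : ∃ S : Finset (ZMod m × ZMod m), S.card = k := by
    obtain ⟨S, _, hS⟩ := Finset.exists_subset_card_eq
      (s := (Finset.univ : Finset (ZMod m × ZMod m))) (n := k) (by simpa [sq, ZMod.card] using hk)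
    exact ⟨S, hS⟩
  have hinj : Function.Injective (lat (m := m)) := by
    intro p q h
    obtain ⟨N, hN⟩ : ∃ N, N ∈ ((lat p).powersetCard 2).toFinset := by
      apply Finset.card_pos.1
      rw [lat_shad_card]
      norm_num
    rw [Multiset.mem_toFinset, Multiset.mem_powersetCard] at hN
    exact lat_sep hN.2 hN.1 (h ▸ hN.1)
  refine ⟨_, ?_, Fin 3 × ZMod m, inferInstance, inferInstance, S.image lat, ?_, rfl, ?_, ?_⟩
  · have : shad 1 (S.image lat) ⊆ (Finset.univ : Finset (Fin 3 × ZMod m)).image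
        fun x => {x} := by
      intro N hN
      obtain ⟨_, _, _, hc⟩ := mem_shad.1 hN
      obtain ⟨x, rfl⟩ := Multiset.card_eq_one.1 hc
      exact Finset.mem_image_of_mem _ (Finset.mem_univ _)
    refine (Finset.card_le_card this).trans (Finset.card_image_le.trans ?_)
    simp [ZMod.card]
  · intro M hM
    obtain ⟨p, _, rfl⟩ := Finset.mem_image.1 hM
    simp [lat]
  · unfold shad
    rw [Finset.image_biUnion, Finset.card_biUnion]
    · rw [Finset.sum_congr rfl (fun p _ => lat_shad_card p)]
      simp [hS, mul_comm]
    · intro p _ q _ hpq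
      rw [Function.onFun, Finset.disjoint_left]
      intro N h1 h2
      rw [Multiset.mem_toFinset, Multiset.mem_powersetCard] at h1 h2
      exact hpq (lat_sep h1.2 h1.1 h2.1)
  · rw [Finset.card_image_of_injective _ hinj, hS]

lemma Realz.isPure {r a t : ℕ} (ht : 0 < t) (h : Realz r a t) : IsPureOSeq (seq4 r a t) 3 := by
  classical
  obtain ⟨V, _, _, G, hG, rfl, rfl, rfl⟩ := h
  let e := Fintype.equivFin V
  let f : Multiset V → (Fin (Fintype.card V) → ℕ) := fun N j => N.count (e.symm j)
  have f_le : ∀ N M, (∀ j, f N j ≤ f M j) ↔ N ≤ M := by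
    intro N M
    rw [Multiset.le_iff_count]
    constructor
    · intro h x
      simpa [f] using h (e x)
    · intro h j
      exact h _
  have f_inj : Function.Injective f := by
    intro N M h
    apply le_antisymm
    · exact (f_le N M).1 (fun j => by rw [h])
    · exact (f_le M N).1 (fun j => by rw [h])
  have f_surj : Function.Surjective f := by
    intro g
    refine ⟨∑ x, g (e x) • {x}, ?_⟩
    funext j
    simp [f, Multiset.count_sum', Multiset.count_singleton]
  have f_deg : ∀ N, monDeg (f N) = N.card := by
    intro N
    unfold monDeg
    rw [Equiv.sum_comp e.symm (fun x => N.count x)]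
    exact Multiset.sum_count_eq_card (fun _ _ => Finset.mem_univ _)
  let X := (G.biUnion fun M => M.powerset.toFinset).image f
  have memX : ∀ N, f N ∈ X ↔ ∃ M ∈ G, N ≤ M := by
    intro N
    simp [X, f_inj.eq_iff]
  obtain ⟨M₀, hM₀⟩ := Finset.card_pos.1 ht
  have hcount : ∀ i, (X.filter fun M => monDeg M = i).card = (shad i G).card := by
    intro i
    rw [← Finset.card_image_of_injective (shad i G) f_inj]
    congr 1
    ext g
    obtain ⟨N, rfl⟩ := f_surj g
    rw [Finset.mem_filter, memX, f_deg, f_inj.mem_finset_image, mem_shad]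
    constructor
    · rintro ⟨⟨M, hM, hle⟩, hc⟩
      exact ⟨M, hM, hle, hc⟩
    · rintro ⟨M, hM, hle, hc⟩
      exact ⟨⟨M, hM, hle⟩, hc⟩
  refine ⟨Fintype.card V, X, ⟨⟨⟨f M₀, (memX _).2 ⟨M₀, hM₀, le_rfl⟩⟩, ?_⟩, ?_, ?_, ?_⟩, ?_⟩
  · intro g hg g' hle
    obtain ⟨N, rfl⟩ := f_surj g
    obtain ⟨N', rfl⟩ := f_surj g'
    rw [f_le] at hle
    rw [memX] at hg ⊢
    obtain ⟨M, hM, h⟩ := hg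
    exact ⟨M, hM, hle.trans h⟩
  · intro g hg
    obtain ⟨N, rfl⟩ := f_surj g
    obtain ⟨M, hM, h⟩ := (memX _).1 hg
    rw [f_deg, ← hG M hM]
    exact Multiset.card_le_card h
  · exact ⟨f M₀, (memX _).2 ⟨M₀, hM₀, le_rfl⟩, by rw [f_deg, hG _ hM₀]⟩
  · rintro g ⟨hg, hmax⟩
    obtain ⟨N, rfl⟩ := f_surj g
    obtain ⟨M, hM, h⟩ := (memX _).1 hg
    have := hmax (f M) ((memX _).2 ⟨M, hM, le_rfl⟩) ((f_le _ _).2 h)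
    rw [← this, f_deg, hG _ hM]
  · intro i hi
    rw [hcount]
    interval_cases i
    · have : shad 0 G = {0} := by
        ext N
        rw [mem_shad, Finset.mem_singleton]
        constructor
        · rintro ⟨_, _, _, h⟩
          simpa using h
        · rintro rfl
          exact ⟨M₀, hM₀, by simp, by simp⟩
      simp [seq4, this]
    · simp [seq4]
    · simp [seq4]
    · rw [shad_self 3 G hG]
      simp [seq4]

lemma multichoose_two' (n : ℕ) : 2 * n.multichoose 2 = n * (n + 1) := by
  induction n with
  | zero => simp
  | succ n ih =>
    rw [Nat.multichoose_succ_succ, Nat.multichoose_one_right, mul_add, ih]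
    ring

lemma multichoose_three' (n : ℕ) : 6 * n.multichoose 3 = n * (n + 1) * (n + 2) := by
  induction n with
  | zero => simp
  | succ n ih =>
    have := multichoose_two' (n + 1)
    rw [Nat.multichoose_succ_succ, mul_add, ih]
    linarith

lemma realz_main {c t r a : ℕ} (hc : 0 < c) (hct : t ≤ c ^ 3) (h1 : 100 * c ^ 2 ≤ r)
    (h2 : r + 100 * c ^ 2 ≤ a) (h3 : a + 100 * c ^ 2 ≤ 3 * t) : Realz r a t := by
  set A := (2 * c).multichoose 2 with hA
  have eA := multichoose_two' (2 * c)
  have eB := multichoose_three' (2 * c)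
  have hcc : c ≤ c ^ 2 := by nlinarith
  have hA1 : A ≤ 3 * c ^ 2 := by rw [← hA] at eA; nlinarith
  have hA2 : 2 * c ≤ A := by rw [← hA] at eA; nlinarith
  have hB : t ≤ (2 * c).multichoose 3 := by nlinarith
  have hm : (a - r - (A - 2 * c)) / 3 ≤ (c ^ 2) ^ 2 := by
    have : c ^ 3 ≤ (c ^ 2) ^ 2 := by
      rw [← pow_mul]; exact Nat.pow_le_pow_right hc (by norm_num)
    omega
  obtain ⟨ρ, hρ, hL⟩ := realz_latin (c ^ 2) ((a - r - (A - 2 * c)) / 3) (by positivity) hm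
  have hn : (2 * c) ^ 2 = 4 * c ^ 2 := by ring
  set w := c ^ 2 with hw
  have hw1 : 1 ≤ w := by omega
  set D := a - r - (A - 2 * c) with hD
  set k := D / 3 with hk
  set j := D - 3 * k + ρ with hj
  set r' := r - 2 * c - ρ - 2 * j with hr'
  have hj' : j ≤ 2 + 3 * w := by omega
  have hF := realz_full (2 * c) (t - k - 2 * j - (r' + 2) / 3) (by rw [hn]; omega) (by omega)
  have := ((hF.add hL).add (realz_232.mul j)).add (realz_lin r')
  rw [← hA] at this
  convert this using 1 <;> omega

lemma triangle_card (u : ℕ) :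
    ((Finset.range (u + 1)).sigma fun a => Finset.range (a + 1)).card * 2 = (u + 1) * (u + 2) := by
  rw [Finset.card_sigma]
  simp only [Finset.card_range]
  induction u with
  | zero => simp
  | succ u ih =>
    rw [Finset.sum_range_succ, add_mul, ih]
    ring

lemma count_subset (t : ℕ) :
    {p : ℕ × ℕ | 0 < p.1 ∧ 0 < p.2 ∧ IsPureOSeq (seq4 p.1 p.2 t) 3} ⊆
      ↑(((Finset.range (3 * t + 1)).sigma fun a => Finset.range (a + 1)).image
        fun x : (_ : ℕ) × ℕ => (x.2, x.1)) := by
  rintro ⟨r, a⟩ ⟨_, _, h⟩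
  have := upper_bound h
  simp only [Finset.coe_image, Set.mem_image, Finset.mem_coe, Finset.mem_sigma, Finset.mem_range]
  exact ⟨⟨a, r⟩, by simp only; omega, rfl⟩

lemma count_upper (t : ℕ) : socleDeg3Count t * 2 ≤ (3 * t + 1) * (3 * t + 2) := by
  rw [← triangle_card]
  apply Nat.mul_le_mul_right
  refine (Set.ncard_le_ncard (count_subset t) (Finset.finite_toSet _)).trans ?_
  rw [Set.ncard_coe_finset]
  exact Finset.card_image_le

lemma count_lower {c t : ℕ} (ht : 0 < t) (hc : 0 < c) (hct : t ≤ c ^ 3) (hle : 100 * c ^ 2 ≤ t) :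
    (3 * (t - 100 * c ^ 2)) ^ 2 ≤ socleDeg3Count t * 2 := by
  have hpos : 0 < c ^ 2 := by positivity
  set E := 100 * c ^ 2 with hE
  have h1 : ((Finset.range (3 * (t - E) + 1)).sigma fun a => Finset.range (a + 1)).card ≤
      socleDeg3Count t := by
    have hinj : Function.Injective (fun x : (_ : ℕ) × ℕ => (x.2 + E, x.1 + 2 * E)) := by
      rintro ⟨a, b⟩ ⟨a', b'⟩ h
      simp only [Prod.mk.injEq] at h
      obtain ⟨h1, h2⟩ := h
      obtain rfl : a = a' := by omega
      obtain rfl : b = b' := by omega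
      rfl
    rw [← Finset.card_image_of_injective _ hinj, ← Set.ncard_coe_finset]
    refine Set.ncard_le_ncard ?_ ((Finset.finite_toSet _).subset (count_subset t))
    intro p hp
    simp only [Finset.coe_image, Set.mem_image, Finset.mem_coe, Finset.mem_sigma,
      Finset.mem_range] at hp
    obtain ⟨⟨a, r⟩, h, rfl⟩ := hp
    simp only at h
    refine ⟨by simp only; omega, by simp only; omega, Realz.isPure ht ?_⟩
    exact realz_main hc hct (by simp only; omega) (by simp only; omega) (by simp only; omega)
  have h2 := triangle_card (3 * (t - E))
  nlinarith

/-- `lim_{t→∞} P(t)/t² = 9/2`. -/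
theorem socle_degree_three_count_asymptotics :
    Tendsto (fun t : ℕ => (socleDeg3Count t : ℝ) / (t : ℝ) ^ 2) atTop
      (nhds (9 / 2)) := by
  have hinv : Tendsto (fun t : ℕ => ((t : ℝ))⁻¹) atTop (nhds 0) :=
    tendsto_inv_atTop_zero.comp tendsto_natCast_atTop_atTop
  have hroot : Tendsto (fun t : ℕ => (t : ℝ) ^ (-(1 / 3 : ℝ))) atTop (nhds 0) :=
    (tendsto_rpow_neg_atTop (by norm_num)).comp tendsto_natCast_atTop_atTop
  have hup : Tendsto (fun t : ℕ => (3 + ((t : ℝ))⁻¹) * (3 + 2 * ((t : ℝ))⁻¹) / 2) atTop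
      (nhds (9 / 2)) := by
    have := (((hinv.const_add 3).mul ((hinv.const_mul 2).const_add 3)).div_const 2)
    convert this using 2
    norm_num
  have hlow : Tendsto (fun t : ℕ => (3 * (1 - 400 * (t : ℝ) ^ (-(1 / 3 : ℝ)))) ^ 2 / 2) atTop
      (nhds (9 / 2)) := by
    have := ((((hroot.const_mul 400).const_sub 1).const_mul 3).pow 2).div_const 2
    convert this using 2
    norm_num
  refine tendsto_of_tendsto_of_tendsto_of_le_of_le' hlow hup ?_ ?_
  · have hsmall : ∀ᶠ t : ℕ in atTop, (t : ℝ) ^ (-(1 / 3 : ℝ)) < 1 / 400 :=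
      hroot.eventually (gt_mem_nhds (by norm_num))
    filter_upwards [hsmall, eventually_ge_atTop 1] with t hs ht
    have ht1 : (1 : ℝ) ≤ t := by exact_mod_cast ht
    have ht0 : (0 : ℝ) < t := by linarith
    set x : ℝ := (t : ℝ) ^ (1 / 3 : ℝ) with hx
    have hx1 : 1 ≤ x := Real.one_le_rpow ht1 (by norm_num)
    have hx3 : x ^ 3 = t := by
      rw [hx, ← Real.rpow_natCast, ← Real.rpow_mul ht0.le]
      norm_num
    have hxinv : (t : ℝ) ^ (-(1 / 3 : ℝ)) = x⁻¹ := by rw [Real.rpow_neg ht0.le]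
    rw [hxinv] at hs ⊢
    set c := ⌈x⌉₊ with hcdef
    have hc0 : 0 < c := Nat.ceil_pos.2 (by linarith)
    have hcx : x ≤ c := Nat.le_ceil x
    have hcx' : (c : ℝ) ≤ 2 * x := by
      have := Nat.ceil_lt_add_one (show 0 ≤ x by linarith)
      linarith
    have hct : t ≤ c ^ 3 := by
      have : (t : ℝ) ≤ (c : ℝ) ^ 3 := by
        rw [← hx3]
        gcongr
      exact_mod_cast this
    have hx400 : 400 < x := by
      rw [inv_lt_comm₀ (by linarith) (by norm_num)] at hs
      norm_num at hs
      exact hs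
    have hE : 100 * (c : ℝ) ^ 2 ≤ 400 * x ^ 2 := by nlinarith
    have hEt : 400 * x ^ 2 ≤ t := by rw [← hx3]; nlinarith [sq_nonneg x]
    have hle : 100 * c ^ 2 ≤ t := by
      have : 100 * (c : ℝ) ^ 2 ≤ t := hE.trans hEt
      exact_mod_cast this
    have hfin := count_lower ht hc0 hct hle
    have hfin' : (3 * ((t : ℝ) - 100 * (c : ℝ) ^ 2)) ^ 2 ≤ socleDeg3Count t * 2 := by
      have : (((3 * (t - 100 * c ^ 2)) ^ 2 : ℕ) : ℝ) ≤ ((socleDeg3Count t * 2 : ℕ) : ℝ) := by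
        exact_mod_cast hfin
      push_cast [Nat.cast_sub hle] at this
      exact this
    rw [le_div_iff₀ (by positivity)]
    have e : (3 * (1 - 400 * x⁻¹)) ^ 2 / 2 * (t : ℝ) ^ 2 = (3 * ((t : ℝ) - 400 * x ^ 2)) ^ 2 / 2 := by
      have hx0 : x ≠ 0 := by linarith
      rw [← hx3]
      field_simp
    rw [e]
    have : (3 * ((t : ℝ) - 400 * x ^ 2)) ^ 2 ≤ (3 * ((t : ℝ) - 100 * (c : ℝ) ^ 2)) ^ 2 := by
      apply pow_le_pow_left₀ <;> linarith
    linarith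
  · filter_upwards [eventually_ge_atTop 1] with t ht
    have ht0 : (0 : ℝ) < t := by exact_mod_cast ht
    rw [div_le_iff₀ (by positivity)]
    have h : ((socleDeg3Count t * 2 : ℕ) : ℝ) ≤ (((3 * t + 1) * (3 * t + 2) : ℕ) : ℝ) := by
      exact_mod_cast count_upper t
    push_cast at h
    have e : (3 + ((t : ℝ))⁻¹) * (3 + 2 * ((t : ℝ))⁻¹) / 2 * (t : ℝ) ^ 2 =
        (3 * t + 1) * (3 * t + 2) / 2 := by
      field_simp
    rw [e]
    linarith
end

section
/- Let k be a field of characteristic zero, R = k[x, y, z], and let I ⊂ R be a monomial ideal such that A = R/I is Artinian and level of type 2. Then A has the Weak Lefschetz Property: there exists a linear form L ∈ A_1 such that for every integer j ≥ 0 the multiplication map ×L : A_j → A_{j+1} is injective or surjective. -/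
section helpers
open Polynomial

lemma wlp_antidiff (n : ℕ) (Q : ℚ[X]) (hQ : Q.degree < n) :
    ∃ P : ℚ[X], P.degree < (n + 1 : ℕ) ∧ ∀ x : ℚ, P.eval (x + 1) - P.eval x = Q.eval x := by
  classical
  refine ⟨∑ k ∈ Finset.range n, C (Q.coeff k / (k + 1)) * Polynomial.bernoulli (k + 1), ?_, ?_⟩
  · rw [← Polynomial.mem_degreeLT]
    refine Submodule.sum_mem _ fun k hk => ?_
    rw [Polynomial.mem_degreeLT, Polynomial.degree_lt_iff_coeff_zero]
    intro m hm
    have hk := Finset.mem_range.1 hk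
    rw [coeff_C_mul, coeff_bernoulli, if_neg (by omega), mul_zero]
  · intro x
    rw [eval_finsetSum, eval_finsetSum, ← Finset.sum_sub_distrib]
    by_cases hQ0 : Q = 0
    · simp [hQ0]
    rw [Polynomial.eval_eq_sum_range' ((Polynomial.natDegree_lt_iff_degree_lt hQ0).2 hQ)]
    refine Finset.sum_congr rfl fun k _ => ?_
    rw [eval_mul, eval_mul, add_comm x 1, bernoulli_eval_one_add]
    have : (k : ℚ) + 1 ≠ 0 := by positivity
    simp only [eval_C, Nat.cast_add, Nat.cast_one, Nat.add_sub_cancel]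
    field_simp
    ring

lemma wlp_layers (n : ℕ) (h : ℕ → ℤ → ℚ) (s t : ℤ)
    (h0 : ∀ i, s ≤ i → i ≤ t → h 0 i = 0)
    (hrec : ∀ m, m < n → ∀ i, s ≤ i → i ≤ t + m → h m i = h (m + 1) (i + 1) - h (m + 1) i) :
    ∃ P : ℚ[X], P.degree < (n : ℕ) ∧ ∀ i : ℤ, s ≤ i → i ≤ t + n → h n i = P.eval (i : ℚ) := by
  induction n with
  | zero => exact ⟨0, by simp, by simpa using h0⟩
  | succ n ih =>
    obtain ⟨Q, hQ, hQe⟩ := ih (fun m hm => hrec m (by omega))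
    obtain ⟨P, hP, hPe⟩ := wlp_antidiff n Q hQ
    refine ⟨P + C (h (n + 1) s - P.eval (s : ℚ)), ?_, ?_⟩
    · rw [← Polynomial.mem_degreeLT] at hP ⊢
      refine Submodule.add_mem _ hP ?_
      rw [Polynomial.mem_degreeLT]
      exact lt_of_le_of_lt degree_C_le (by exact_mod_cast Nat.succ_pos n)
    · intro i hi
      induction i, hi using Int.leInduction with
      | base => intro _; simp
      | succ i hi ih2 =>
        intro hi2
        have e1 := ih2 (by push_cast at *; omega)
        have e2 := hrec n (by omega) i hi (by push_cast at *; omega)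
        have e3 := hQe i hi (by push_cast at *; omega)
        have e4 := hPe i
        simp only [eval_add, eval_C] at e1 ⊢
        push_cast
        linarith

lemma wlp_diff_degree (n : ℕ) (r : ℚ) (P : ℚ[X]) (hP : P.degree < (n + 1 : ℕ)) :
    (P.comp (X + C r) - P).degree < n := by
  rw [Polynomial.degree_lt_iff_coeff_zero]
  intro m hm
  by_cases hP0 : P = 0
  · simp [hP0]
  have hd : P.natDegree ≤ n := by
    have := (Polynomial.natDegree_lt_iff_degree_lt hP0).2 hP
    omega
  rw [coeff_sub, sub_eq_zero]
  have h2 : (P.comp (X + C r)).natDegree = P.natDegree := by simp [natDegree_comp]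
  rcases lt_or_eq_of_le (hd.trans hm) with h | h
  · rw [coeff_eq_zero_of_natDegree_lt h, coeff_eq_zero_of_natDegree_lt (by omega)]
  · rw [← h]
    have : (P.comp (X + C r)).leadingCoeff = P.leadingCoeff := by
      rw [leadingCoeff_comp (by simp)]; simp
    rw [leadingCoeff, h2] at this
    exact this

/-- repeated differences vanish -/
lemma wlp_iter_diff (r s : ℚ) (n : ℕ) (P : ℚ[X]) (hP : P.degree < n) :
    ∃ D : ℕ → ℚ → ℚ, (∀ x, D 0 x = P.eval x) ∧
      (∀ m x, D (m + 1) x = s * (D m (x + r) - D m x)) ∧ ∀ x, D n x = 0 := by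
  induction n generalizing P with
  | zero =>
    have : P = 0 := by simpa using hP
    refine ⟨fun _ _ => 0, by simp [this], by simp, by simp⟩
  | succ n ih =>
    obtain ⟨D, hD0, hDs, hDn⟩ := ih (C s * (P.comp (X + C r) - P))
      (lt_of_le_of_lt (by rw [degree_mul]; by_cases hs : s = 0 <;> simp [hs])
        (wlp_diff_degree n r P hP))
    refine ⟨fun m => Nat.casesOn m (fun x => P.eval x) D, by simp, ?_, by simpa using hDn⟩
    intro m x
    cases m with
    | zero => simp [hD0]
    | succ m => simp [hDs]

lemma wlp_zero_of_zeros (Z : Finset ℤ) (n : ℕ) (hn : n ≤ Z.card) (P : ℚ[X]) (hP : P.degree < n)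
    (hz : ∀ r ∈ Z, P.eval (r : ℚ) = 0) : P = 0 := by
  refine eq_zero_of_degree_lt_of_eval_index_eq_zero (v := fun i : ℤ => (i : ℚ)) Z
    (Int.cast_injective.injOn) (lt_of_lt_of_le hP (by exact_mod_cast hn)) hz

lemma wlp_sep (T : Set ℤ) (Z : Finset ℤ)
    (hZ : ∀ r ∈ Z, (∀ i ∈ T, r < i) ∨ (∀ i ∈ T, i < r)) :
    ∃ z : ℚ[X], (∀ n : ℕ, ∀ u : ℚ[X], u.degree < (n - Z.card : ℕ) → (z * u).degree < n) ∧
      (∀ i ∈ Z, z.eval (i : ℚ) = 0) ∧ (∀ i : ℤ, i ∉ Z → z.eval (i : ℚ) ≠ 0) ∧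
      (∀ i ∈ T, 0 < z.eval (i : ℚ)) ∧
      ∀ n : ℕ, ∀ P : ℚ[X], P.degree < n → (∀ r ∈ Z, P.eval (r : ℚ) = 0) →
        ∃ u : ℚ[X], P = z * u ∧ u.degree < (n - Z.card : ℕ) := by
  classical
  induction Z using Finset.induction_on with
  | empty => exact ⟨1, by simp⟩
  | insert r Z hr ih =>
    obtain ⟨z, h1, h2, h3, h4, h5⟩ := ih (fun r hr => hZ r (by simp [hr]))
    obtain ⟨ε, hε, hεT⟩ : ∃ ε : ℚ, ε ≠ 0 ∧ ∀ i ∈ T, 0 < ε * ((i : ℚ) - r) := by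
      rcases hZ r (by simp) with h | h
      · refine ⟨1, by simp, fun i hi => ?_⟩
        have : (r : ℚ) < i := by exact_mod_cast h i hi
        linarith
      · refine ⟨-1, by simp, fun i hi => ?_⟩
        have : (i : ℚ) < r := by exact_mod_cast h i hi
        linarith
    have hdeg : (C ε * (X - C (r : ℚ))).degree = 1 := by
      rw [degree_C_mul hε, degree_X_sub_C]
    refine ⟨z * (C ε * (X - C (r : ℚ))), ?_, ?_, ?_, ?_, ?_⟩
    · intro n u hu
      rw [mul_assoc]
      apply h1
      by_cases hu0 : u = 0
      · rw [hu0, mul_zero, degree_zero]; exact WithBot.bot_lt_coe _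
      rw [degree_mul, hdeg, degree_eq_natDegree hu0]
      rw [degree_eq_natDegree hu0] at hu
      rw [Finset.card_insert_of_notMem hr] at hu
      have : u.natDegree < n - (Z.card + 1) := by exact_mod_cast hu
      have : 1 + u.natDegree < n - Z.card := by omega
      exact_mod_cast this
    · intro i hi
      rcases Finset.mem_insert.1 hi with rfl | hi
      · simp
      · simp [h2 i hi]
    · intro i hi
      have hi' : i ≠ r ∧ i ∉ Z := by simpa using hi
      have : (i : ℚ) - r ≠ 0 := sub_ne_zero.2 (by exact_mod_cast hi'.1)
      simp only [eval_mul, eval_C, eval_sub, eval_X]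
      exact mul_ne_zero (h3 i hi'.2) (mul_ne_zero hε this)
    · intro i hi
      simp only [eval_mul, eval_C, eval_sub, eval_X]
      exact mul_pos (h4 i hi) (hεT i hi)
    · intro n P hP hPz
      obtain ⟨u, rfl, hu⟩ := h5 n P hP (fun r hr => hPz r (by simp [hr]))
      have hur : u.IsRoot (r : ℚ) := by
        have := hPz r (by simp)
        rw [eval_mul] at this
        exact (mul_eq_zero.1 this).resolve_left (h3 r hr)
      obtain ⟨w, rfl⟩ := dvd_iff_isRoot.2 hur
      refine ⟨C ε⁻¹ * w, ?_, ?_⟩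
      · have : C ε * C ε⁻¹ = (1 : ℚ[X]) := by rw [← C_mul, mul_inv_cancel₀ hε, C_1]
        linear_combination (-(z * (X - C (r : ℚ)) * w)) * this
      · rw [degree_C_mul (inv_ne_zero hε), Finset.card_insert_of_notMem hr]
        by_cases hw : w = 0
        · rw [hw, degree_zero]; exact WithBot.bot_lt_coe _
        rw [degree_mul, degree_X_sub_C, degree_eq_natDegree hw] at hu
        rw [degree_eq_natDegree hw]
        have : 1 + w.natDegree < n - Z.card := by exact_mod_cast hu
        have : w.natDegree < n - (Z.card + 1) := by omega
        exact_mod_cast this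

lemma wlp_parts (N : ℕ) (g φ : ℤ → ℚ) :
    ∑ i ∈ Finset.range (N + 1), (g ((i : ℤ) - 1) - g i) * φ i =
      ∑ i ∈ Finset.range N, g i * (φ ((i : ℤ) + 1) - φ i) + g (-1) * φ 0 - g N * φ N := by
  induction N with
  | zero => simp; ring
  | succ N ih =>
    rw [Finset.sum_range_succ, ih, Finset.sum_range_succ]
    push_cast
    rw [add_sub_cancel_right]
    ring
end helpers

section core
open Polynomial

/-- The region of exponents `(i, y, c)` dividing one of the two socle monomials. -/
def wlpReg (α β a b p q i y c : ℤ) : Prop :=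
  0 ≤ i ∧ 0 ≤ y ∧ 0 ≤ c ∧ ((i < α ∧ y < β ∧ c < p) ∨ (i < a ∧ y < b ∧ c < p + q))

lemma wlp_ker_poly (f : ℤ → ℤ → ℚ) (A B j c0 : ℤ) (n : ℕ)
    (h0 : ∀ i, i < A → j + 1 - i - c0 < B → f i (c0 - 1) = 0)
    (hrec : ∀ c i, c0 ≤ c → c < c0 + n → i < A → j + 1 - i - c < B →
      f i (c - 1) = f (i - 1) c - f i c) :
    ∃ P : ℚ[X], P.degree < (n : ℕ) ∧
      ∀ i : ℤ, i < A → j - i - (c0 + n - 1) < B → f i (c0 + n - 1) = P.eval (i : ℚ) := by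
  obtain ⟨P, hP, hPe⟩ := wlp_layers n (fun m i => f (-i) (c0 - 1 + m)) (-(A - 1)) (B + c0 - j - 2)
    (by
      intro i h1 h2
      simpa using h0 (-i) (by omega) (by omega))
    (by
      intro m hm i h1 h2
      have := hrec (c0 + m) (-i) (by omega) (by omega) (by omega) (by omega)
      have e1 : c0 + (m : ℤ) - 1 = c0 - 1 + m := by ring
      have e2 : c0 - 1 + ((m + 1 : ℕ) : ℤ) = c0 + m := by push_cast; ring
      have e3 : -(i + 1) = -i - 1 := by ring
      simp only [e2, e3]
      rw [← e1, this])
  refine ⟨P.comp (-X), ?_, ?_⟩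
  · by_cases hP0 : P = 0
    · simp [hP0]
    rw [degree_eq_natDegree hP0] at hP
    refine lt_of_le_of_lt degree_le_natDegree ?_
    simpa [natDegree_comp] using hP
  · intro i h1 h2
    have := hPe (-i) (by omega) (by omega)
    have e1 : c0 - 1 + (n : ℤ) = c0 + n - 1 := by ring
    simp only [neg_neg, e1] at this
    rw [this]
    simp

lemma wlp_coker_poly (F : ℤ → ℤ → ℚ) (j c0 : ℤ) (n : ℕ)
    (h0 : ∀ i, F i (c0 + n) = 0)
    (hrec : ∀ c i, c0 ≤ c → c < c0 + n → 0 ≤ i → i ≤ j - c →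
      F i (c + 1) = F (i + 1) c - F i c) :
    ∃ P : ℚ[X], P.degree < (n : ℕ) ∧
      ∀ i : ℤ, 0 ≤ i → i ≤ j + 1 - c0 → F i c0 = P.eval (i : ℚ) := by
  obtain ⟨P, hP, hPe⟩ := wlp_layers n (fun m i => F i (c0 + n - m)) 0 (j + 1 - c0 - n)
    (by
      intro i h1 h2
      simpa using h0 i)
    (by
      intro m hm i h1 h2
      have := hrec (c0 + n - m - 1) i (by omega) (by omega) (by omega) (by omega)
      have e2 : c0 + (n : ℤ) - ((m + 1 : ℕ) : ℤ) = c0 + n - m - 1 := by push_cast; ring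
      simp only [e2]
      rw [← this, sub_add_cancel])
  refine ⟨P, hP, ?_⟩
  intro i h1 h2
  have := hPe i (by omega) (by omega)
  simpa using this

/-- first pairing identity -/
lemma wlp_pair_f (a b : ℤ) (c0 : ℤ) (d q : ℕ) (f : ℤ → ℤ → ℚ) (φ : ℚ[X]) (hφ : φ.degree < q)
    (hφz : ∀ i : ℤ, 0 ≤ i → i ≤ d → (a ≤ i ∨ b ≤ d - i) → φ.eval (i : ℚ) = 0)
    (hneg : ∀ m : ℕ, f (-1) (c0 + m + 1) = 0)
    (hpos : ∀ m : ℕ, f (d - m) (c0 + m + 1) = 0)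
    (hrec : ∀ m : ℕ, m < q → ∀ i, 0 ≤ i → i < a → 0 ≤ d - m - i → d - m - i < b →
      f i (c0 + m) = f (i - 1) (c0 + m + 1) - f i (c0 + m + 1)) :
    ∑ i ∈ Finset.range (d + 1), f i c0 * φ.eval (i : ℚ) = 0 := by
  obtain ⟨D, hD0, hDs, hDn⟩ := wlp_iter_diff 1 1 q φ hφ
  have hV : ∀ m : ℕ, ∀ i : ℤ, 0 ≤ i → i ≤ d - m → (a ≤ i ∨ b ≤ d - m - i) → D m i = 0 := by
    intro m
    induction m with
    | zero => intro i h1 h2 h3; rw [hD0]; exact hφz i h1 (by simpa using h2) (by simpa using h3)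
    | succ m ih =>
      intro i h1 h2 h3
      push_cast at h2 h3
      have e1 := ih i h1 (by omega) (by omega)
      have e2 := ih (i + 1) (by omega) (by omega) (by omega)
      push_cast at e2
      rw [hDs, e1, e2]; ring
  have key : ∀ m : ℕ, m ≤ q → ∑ i ∈ Finset.range (d + 1), f i c0 * φ.eval (i : ℚ) =
      ∑ i ∈ Finset.range (d + 1 - m), f i (c0 + m) * D m i := by
    intro m
    induction m with
    | zero => intro _; simp [hD0]
    | succ m ih =>
      intro hm
      rw [ih (by omega)]
      by_cases hdm : d < m
      · rw [show d + 1 - m = 0 by omega, show d + 1 - (m + 1) = 0 by omega]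
        simp
      obtain ⟨N, hN⟩ : ∃ N, d = N + m := ⟨d - m, by omega⟩
      rw [show d + 1 - m = N + 1 by omega, show d + 1 - (m + 1) = N by omega]
      have e := wlp_parts N (fun i => f i (c0 + m + 1)) (fun i => D m i)
      have e1 : f N (c0 + m + 1) = 0 := by
        have := hpos m
        rwa [show (d : ℤ) - m = N by omega] at this
      simp only [hneg m, e1] at e
      rw [zero_mul, zero_mul, add_zero, sub_zero] at e
      refine Eq.trans ?_ (e.trans ?_)
      · refine Finset.sum_congr rfl fun i hi => ?_
        have hi := Finset.mem_range.1 hi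
        by_cases h : (i : ℤ) < a ∧ (d : ℤ) - m - i < b
        · rw [hrec m (by omega) i (by omega) h.1 (by omega) h.2]
          simp
        · have := hV m i (by omega) (by omega) (by omega)
          push_cast at this
          simp [this]
      · refine Finset.sum_congr rfl fun i hi => ?_
        rw [hDs]
        push_cast
        rw [one_mul, add_assoc]
  rw [key q le_rfl]
  exact Finset.sum_eq_zero fun i _ => by rw [hDn, mul_zero]

/-- second pairing identity -/
lemma wlp_pair_F (α β : ℤ) (hα : 0 ≤ α) (hβ : 0 ≤ β) (d p : ℕ) (F : ℤ → ℤ → ℚ) (ψ : ℚ[X])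
    (hψ : ψ.degree < p)
    (hψz : ∀ i : ℤ, i < α → d - i < β → (i < 0 ∨ d < i) → ψ.eval (i : ℚ) = 0)
    (hz : ∀ m : ℕ, m < p → ∀ i : ℤ, (α ≤ i ∨ β ≤ d + m + 1 - i) → F i (p - m - 1) = 0)
    (hrec : ∀ m : ℕ, m < p → ∀ i : ℤ, 0 ≤ i → i ≤ d + m →
      F i (p - m) = F (i + 1) (p - m - 1) - F i (p - m - 1)) :
    ∑ i ∈ Finset.range (d + 1), F i p * ψ.eval (i : ℚ) = 0 := by
  obtain ⟨D, hD0, hDs, hDn⟩ := wlp_iter_diff (-1) 1 p ψ hψ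
  have hV : ∀ m : ℕ, ∀ i : ℤ, i < α → d + m - i < β → (i < 0 ∨ d + m < i) → D m i = 0 := by
    intro m
    induction m with
    | zero => intro i h1 h2 h3; rw [hD0]; exact hψz i h1 (by simpa using h2) (by simpa using h3)
    | succ m ih =>
      intro i h1 h2 h3
      push_cast at h2 h3
      have e1 := ih i h1 (by omega) (by omega)
      have e2 := ih (i - 1) (by omega) (by omega) (by omega)
      push_cast at e2
      rw [hDs, e1, ← sub_eq_add_neg, e2]; ring
  have key : ∀ m : ℕ, m ≤ p → ∑ i ∈ Finset.range (d + 1), F i p * ψ.eval (i : ℚ) =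
      ∑ i ∈ Finset.range (d + 1 + m), F i (p - m) * D m i := by
    intro m
    induction m with
    | zero => intro _; simp [hD0]
    | succ m ih =>
      intro hm
      rw [ih (by omega)]
      have e := wlp_parts (d + m + 1) (fun i => D m i) (fun i => F i (p - m - 1))
      have e1 : D m (-1) * F 0 (p - m - 1) = 0 := by
        by_cases h : β ≤ d + m + 1
        · rw [hz m (by omega) 0 (by omega), mul_zero]
        · have := hV m (-1) (by omega) (by omega) (by omega)
          push_cast at this
          rw [this, zero_mul]
      have e2 : D m ((d + m + 1 : ℕ) : ℤ) * F ((d + m + 1 : ℕ) : ℤ) (p - m - 1) = 0 := by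
        by_cases h : α ≤ d + m + 1
        · rw [hz m (by omega) _ (by push_cast; omega), mul_zero]
        · rw [hV m ((d + m + 1 : ℕ) : ℤ) (by push_cast; omega) (by push_cast; omega)
            (by push_cast; omega), zero_mul]
      simp only [Int.cast_neg, Int.cast_one, e2] at e
      rw [e1, add_zero, sub_zero] at e
      rw [show d + 1 + m = d + m + 1 by ring, show d + 1 + (m + 1) = d + m + 1 + 1 by ring]
      refine Eq.trans ?_ (e.symm.trans ?_)
      · refine Finset.sum_congr rfl fun i hi => ?_
        have hi := Finset.mem_range.1 hi
        rw [hrec m (by omega) i (by omega) (by omega), mul_comm]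
        simp
      · refine Finset.sum_congr rfl fun i hi => ?_
        rw [hDs]
        push_cast
        rw [one_mul, mul_comm, ← sub_eq_add_neg, sub_add_eq_sub_sub]
  rw [key p le_rfl]
  exact Finset.sum_eq_zero fun i _ => by rw [hDn, mul_zero]
end core

section core2
open Polynomial

lemma wlp_core (α β a b j : ℤ) (p q : ℕ) (ha : 0 ≤ a) (hb : 0 ≤ b) (haα : a ≤ α) (hbβ : b ≤ β)
    (hsum : α + β = a + b + q) (f F : ℤ → ℤ → ℚ)
    (hf0 : ∀ i c, ¬ wlpReg α β a b p q i (j - i - c) c → f i c = 0)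
    (hF0 : ∀ i c, ¬ wlpReg α β a b p q i (j + 1 - i - c) c → F i c = 0)
    (hf : ∀ i c, wlpReg α β a b p q i (j + 1 - i - c) c → f i (c - 1) = f (i - 1) c - f i c)
    (hF : ∀ i c, wlpReg α β a b p q i (j - i - c) c → F i (c + 1) = F (i + 1) c - F i c) :
    (∀ i c, f i c = 0) ∨ (∀ i c, F i c = 0) := by
  by_contra hcon
  rw [not_or] at hcon
  obtain ⟨hfne, hFne⟩ := hcon
  unfold wlpReg at *
  -- recursions on extended windows
  have f1 : ∀ c i, 0 ≤ c → c < 0 + (p : ℤ) → i < α → j + 1 - i - c < β →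
      f i (c - 1) = f (i - 1) c - f i c := by
    intro c i h1 h2 h3 h4
    by_cases h : 0 ≤ i ∧ 0 ≤ j + 1 - i - c
    · exact hf i c (by omega)
    · rw [hf0 i (c - 1) (by omega), hf0 (i - 1) c (by omega), hf0 i c (by omega), sub_zero]
  have f2 : ∀ c i, (p : ℤ) ≤ c → c < p + (q : ℤ) → i < a → j + 1 - i - c < b →
      f i (c - 1) = f (i - 1) c - f i c := by
    intro c i h1 h2 h3 h4
    by_cases h : 0 ≤ i ∧ 0 ≤ j + 1 - i - c
    · exact hf i c (by omega)
    · rw [hf0 i (c - 1) (by omega), hf0 (i - 1) c (by omega), hf0 i c (by omega), sub_zero]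
  have F1 : ∀ c i, 0 ≤ c → c < 0 + (p : ℤ) → 0 ≤ i → i ≤ j - c →
      F i (c + 1) = F (i + 1) c - F i c := by
    intro c i h1 h2 h3 h4
    by_cases h : i < α ∧ j - i - c < β
    · exact hF i c (by omega)
    · rw [hF0 i (c + 1) (by omega), hF0 (i + 1) c (by omega), hF0 i c (by omega), sub_zero]
  have F2 : ∀ c i, (p : ℤ) ≤ c → c < p + (q : ℤ) → 0 ≤ i → i ≤ j - c →
      F i (c + 1) = F (i + 1) c - F i c := by
    intro c i h1 h2 h3 h4
    by_cases h : i < a ∧ j - i - c < b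
    · exact hF i c (by omega)
    · rw [hF0 i (c + 1) (by omega), hF0 (i + 1) c (by omega), hF0 i c (by omega), sub_zero]
  -- propagation of vanishing
  have pf1 : (∀ i, f i (p - 1) = 0) → ∀ i c : ℤ, c < p → f i c = 0 := by
    intro h0
    have : ∀ n : ℕ, ∀ i, f i (p - 1 - n) = 0 := by
      intro n
      induction n with
      | zero => simpa using h0
      | succ n ih =>
        intro i
        by_cases h : 0 ≤ i ∧ i < α ∧ 0 ≤ j - i - (p - 1 - (n + 1 : ℕ)) ∧
            j - i - (p - 1 - (n + 1 : ℕ)) < β ∧ 0 ≤ (p : ℤ) - 1 - (n + 1 : ℕ)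
        · have := f1 (p - 1 - n) i (by omega) (by omega) (by omega) (by omega)
          rw [ih, ih, sub_zero] at this
          rw [← this]; congr 1; push_cast; ring
        · exact hf0 _ _ (by omega)
    intro i c hc
    have := this (p - 1 - c).toNat i
    rwa [show (p : ℤ) - 1 - ((p - 1 - c).toNat : ℤ) = c by omega] at this
  have pf2 : (∀ i, f i (p + q - 1) = 0) → ∀ i c, (p : ℤ) ≤ c → f i c = 0 := by
    intro h0
    have : ∀ n : ℕ, ∀ i, (p : ℤ) ≤ p + q - 1 - n → f i (p + q - 1 - n) = 0 := by
      intro n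
      induction n with
      | zero => intro i _; simpa using h0 i
      | succ n ih =>
        intro i hn
        by_cases h : 0 ≤ i ∧ i < a ∧ 0 ≤ j - i - (p + q - 1 - (n + 1 : ℕ)) ∧
            j - i - (p + q - 1 - (n + 1 : ℕ)) < b
        · have := f2 (p + q - 1 - n) i (by omega) (by omega) (by omega) (by omega)
          rw [ih _ (by omega), ih _ (by omega), sub_zero] at this
          rw [← this]; congr 1; push_cast; ring
        · exact hf0 _ _ (by omega)
    intro i c hc
    by_cases hc2 : c < p + q
    · have := this (p + q - 1 - c).toNat i (by omega)
      rwa [show (p : ℤ) + q - 1 - ((p + q - 1 - c).toNat : ℤ) = c by omega] at this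
    · exact hf0 _ _ (by omega)
  have pF1 : (∀ i, F i 0 = 0) → ∀ i c : ℤ, c < p → F i c = 0 := by
    intro h0
    have : ∀ n : ℕ, (n : ℤ) < p → ∀ i, F i n = 0 := by
      intro n
      induction n with
      | zero => intro _ i; simpa using h0 i
      | succ n ih =>
        intro hn i
        by_cases h : 0 ≤ i ∧ i < α ∧ 0 ≤ j + 1 - i - (n + 1 : ℕ) ∧
            j + 1 - i - (n + 1 : ℕ) < β
        · have := F1 n i (by omega) (by omega) (by omega) (by omega)
          rw [ih (by omega), ih (by omega), sub_zero] at this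
          rw [← this]; congr 1
        · exact hF0 _ _ (by omega)
    intro i c hc
    by_cases hc2 : 0 ≤ c
    · lift c to ℕ using hc2
      exact this c hc i
    · exact hF0 _ _ (by omega)
  have pF2 : (∀ i, F i p = 0) → ∀ i c, (p : ℤ) ≤ c → F i c = 0 := by
    intro h0
    have : ∀ n : ℕ, ∀ i, F i (p + n) = 0 := by
      intro n
      induction n with
      | zero => intro i; simpa using h0 i
      | succ n ih =>
        intro i
        by_cases h : 0 ≤ i ∧ i < a ∧ 0 ≤ j + 1 - i - (p + (n + 1 : ℕ)) ∧
            j + 1 - i - (p + (n + 1 : ℕ)) < b ∧ p + (n + 1 : ℕ) < p + q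
        · have := F2 (p + n) i (by omega) (by omega) (by omega) (by omega)
          rw [ih, ih, sub_zero] at this
          rw [← this]; congr 1
        · exact hF0 _ _ (by omega)
    intro i c hc
    have := this (c - p).toNat i
    rwa [show (p : ℤ) + ((c - p).toNat : ℤ) = c by omega] at this
  -- (1)
  have step1 : (∀ i, f i (p - 1) = 0) → α + β + 2 * p - 4 < 2 * j := by
    intro h0
    by_contra hj
    apply hfne
    have low := pf1 h0
    obtain ⟨P, hP, hPe⟩ := wlp_ker_poly f a b j p q (fun i _ _ => h0 i) f2
    have high : ∀ i c, (p : ℤ) ≤ c → f i c = 0 := by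
      apply pf2
      intro i
      by_cases hd : j - (p + q - 1) < 0
      · exact hf0 _ _ (by omega)
      by_cases hi : i < a ∧ j - i - (p + q - 1) < b
      · rw [hPe i hi.1 hi.2]
        have : P = 0 := by
          apply wlp_zero_of_zeros (Finset.Icc (j - (p + q - 1) - b + 1) (-1) ∪
            Finset.Icc (j - (p + q - 1) + 1) (a - 1)) q _ P hP
          · intro r hr
            simp only [Finset.mem_union, Finset.mem_Icc] at hr
            rw [← hPe r (by omega) (by omega)]
            exact hf0 _ _ (by omega)
          · rw [Finset.card_union_of_disjoint, Int.card_Icc, Int.card_Icc]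
            · omega
            · rw [Finset.disjoint_left]
              intro r hr hr2
              simp only [Finset.mem_Icc] at hr hr2
              omega
        rw [this, eval_zero]
      · by_cases hq : q = 0
        · subst hq
          have := h0 i
          simpa using this
        exact hf0 _ _ (by omega)
    intro i c
    by_cases hc : c < p
    · exact low i c hc
    · exact high i c (by omega)
  -- (2)
  have step2 : (∀ i, F i p = 0) → 2 * j < α + β + p - 4 := by
    intro h0
    by_contra hj
    apply hFne
    have high := pF2 h0
    obtain ⟨P, hP, hPe⟩ := wlp_coker_poly F j 0 p (by simpa using h0) F1
    have low : ∀ i c, c < (p : ℤ) → F i c = 0 := by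
      apply pF1
      intro i
      by_cases hi : 0 ≤ i ∧ i ≤ j + 1 ∧ i < α ∧ j + 1 - i < β
      · rw [hPe i hi.1 (by omega)]
        have : P = 0 := by
          apply wlp_zero_of_zeros (Finset.Icc 0 (j + 1 - β) ∪ Finset.Icc α (j + 1)) p _ P hP
          · intro r hr
            simp only [Finset.mem_union, Finset.mem_Icc] at hr
            rw [← hPe r (by omega) (by omega)]
            exact hF0 _ _ (by omega)
          · rw [Finset.card_union_of_disjoint, Int.card_Icc, Int.card_Icc]
            · omega
            · rw [Finset.disjoint_left]
              intro r hr hr2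
              simp only [Finset.mem_Icc] at hr hr2
              omega
        rw [this, eval_zero]
      · exact hF0 _ _ (by omega)
    intro i c
    by_cases hc : c < p
    · exact low i c hc
    · exact high i c (by omega)
  -- the polynomial describing the cokernel
  obtain ⟨φ, hφ, hφe⟩ := wlp_coker_poly F j p q (fun i => hF0 _ _ (by omega)) F2
  obtain ⟨ψ, hψ, hψe⟩ := wlp_ker_poly f α β j 0 p (fun i _ _ => hf0 _ _ (by omega)) f1
  simp only [zero_add] at hψe
  have cardZ2 : ∀ i, F i p ≠ 0 →
      (Finset.Icc 0 (j + 1 - p - b) ∪ Finset.Icc a (j + 1 - p)).card =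
      (j + 1 - p - b + 1 - 0).toNat + (j + 1 - p + 1 - a).toNat := by
    intro i hi
    have hr : 0 ≤ i ∧ i < a ∧ 0 ≤ j + 1 - i - p ∧ j + 1 - i - p < b := by
      by_contra h
      exact hi (hF0 _ _ (by omega))
    rw [Finset.card_union_of_disjoint, Int.card_Icc, Int.card_Icc]
    rw [Finset.disjoint_left]
    intro r hr hr2
    simp only [Finset.mem_Icc] at hr hr2
    omega
  have hφz : ∀ r ∈ Finset.Icc 0 (j + 1 - p - b) ∪ Finset.Icc a (j + 1 - p),
      φ.eval (r : ℚ) = 0 := by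
    intro r hr
    simp only [Finset.mem_union, Finset.mem_Icc] at hr
    rw [← hφe r (by omega) (by omega)]
    exact hF0 _ _ (by omega)
  have hφ0 : φ = 0 → ∀ i, F i p = 0 := by
    intro h i
    by_cases hi : 0 ≤ i ∧ i ≤ j + 1 - p
    · rw [hφe i hi.1 hi.2, h, eval_zero]
    · exact hF0 _ _ (by omega)
  by_cases hg : ∀ i, f i (p - 1) = 0
  · have hj := step1 hg
    have : ∀ i, F i p = 0 := by
      by_contra hne
      obtain ⟨i, hi⟩ := not_forall.1 hne
      have hc := cardZ2 i hi
      refine hne (hφ0 (wlp_zero_of_zeros _ q ?_ φ hφ hφz))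
      rw [hc]
      omega
    have := step2 this
    omega
  obtain ⟨i0, hi0⟩ := not_forall.1 hg
  have hr0 : 0 ≤ i0 ∧ i0 < α ∧ 0 ≤ j - i0 - (p - 1) ∧ j - i0 - (p - 1) < β := by
    by_contra h
    exact hi0 (hf0 _ _ (by omega))
  obtain ⟨d, hd⟩ : ∃ d : ℕ, (d : ℤ) = j + 1 - p := ⟨(j + 1 - p).toNat, by omega⟩
  have hψz : ∀ r ∈ Finset.Icc (d - β + 1) (-1) ∪ Finset.Icc (d + 1) (α - 1),
      ψ.eval (r : ℚ) = 0 := by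
    intro r hr
    simp only [Finset.mem_union, Finset.mem_Icc] at hr
    rw [← hψe r (by omega) (by omega)]
    exact hf0 _ _ (by omega)
  have hψ0 : ψ ≠ 0 := by
    intro h
    apply hi0
    rw [hψe i0 (by omega) (by omega), h, eval_zero]
  have cardZ1 : (Finset.Icc (d - β + 1) (-1) ∪ Finset.Icc ((d : ℤ) + 1) (α - 1)).card =
      (-1 + 1 - (d - β + 1)).toNat + (α - 1 + 1 - (d + 1)).toNat := by
    rw [Finset.card_union_of_disjoint, Int.card_Icc, Int.card_Icc]
    rw [Finset.disjoint_left]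
    intro r hr hr2
    simp only [Finset.mem_Icc] at hr hr2
    omega
  have hj : α + β + p - 4 < 2 * j := by
    by_contra hj
    exact hψ0 (wlp_zero_of_zeros _ p (by rw [cardZ1]; omega) ψ hψ hψz)
  have hFp : ¬ ∀ i, F i p = 0 := by
    intro h
    have := step2 h
    omega
  rw [← hd] at hφz hφe
  clear cardZ2 cardZ1 step1 step2 pf1 pf2 pF1 pF2
  generalize hZ1 : Finset.Icc (d - β + 1) (-1) ∪ Finset.Icc ((d : ℤ) + 1) (α - 1) = Z1 at *
  generalize hZ2 : Finset.Icc 0 (d - b) ∪ Finset.Icc a (d : ℤ) = Z2 at *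
  have mZ1 : ∀ r, r ∈ Z1 ↔ (d - β + 1 ≤ r ∧ r ≤ -1) ∨ (d + 1 ≤ r ∧ r ≤ α - 1) := by
    intro r; rw [← hZ1]; simp
  have mZ2 : ∀ r, r ∈ Z2 ↔ (0 ≤ r ∧ r ≤ d - b) ∨ (a ≤ r ∧ r ≤ d) := by
    intro r; rw [← hZ2]; simp
  have mT : ∀ i : ℤ, i ∈ Finset.Icc (max 0 (d - b + 1)) (min (a - 1) d) ↔
      0 ≤ i ∧ i ≤ d ∧ d - b < i ∧ i < a := by
    intro i; simp only [Finset.mem_Icc]; omega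
  generalize Finset.Icc (max 0 (d - b + 1)) (min (a - 1) (d : ℤ)) = T at mT
  obtain ⟨z1, z1a, z1b, -, z1d, z1e⟩ := wlp_sep (T : Set ℤ) Z1 (by
    intro r hr
    rw [mZ1] at hr
    rcases hr with hr | hr
    · left; intro i hi; have := (mT i).1 hi; omega
    · right; intro i hi; have := (mT i).1 hi; omega)
  obtain ⟨z2, z2a, z2b, -, z2d, z2e⟩ := wlp_sep (T : Set ℤ) Z2 (by
    intro r hr
    rw [mZ2] at hr
    rcases hr with hr | hr
    · left; intro i hi; have := (mT i).1 hi; omega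
    · right; intro i hi; have := (mT i).1 hi; omega)
  obtain ⟨u, hu, hud⟩ := z1e p ψ hψ hψz
  obtain ⟨v, hv, hvd⟩ := z2e q φ hφ hφz
  by_cases hcase : p - Z1.card ≤ q - Z2.card ∧ p - Z1.card ≤ T.card
  · -- use `f`
    have hsumz := wlp_pair_f a b (p - 1) d q f (z2 * u)
      (z2a q u (lt_of_lt_of_le hud (by exact_mod_cast hcase.1)))
      (by
        intro i h1 h2 h3
        rw [eval_mul, z2b i ((mZ2 i).2 (by omega)), zero_mul])
      (fun m => hf0 _ _ (by omega)) (fun m => hf0 _ _ (by omega))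
      (by
        intro m hm i h1 h2 h3 h4
        have := f2 (p + m) i (by omega) (by omega) h2 (by omega)
        rw [show (p : ℤ) - 1 + m = p + m - 1 by ring, sub_add_cancel]
        exact this)
    have hterm : ∀ i ∈ Finset.range (d + 1), f i (p - 1) * (z2 * u).eval (i : ℚ) =
        z1.eval (i : ℚ) * z2.eval (i : ℚ) * u.eval (i : ℚ) ^ 2 := by
      intro i hi
      have hi := Finset.mem_range.1 hi
      by_cases hi2 : (i : ℤ) ∈ Z2
      · have := z2b _ hi2
        push_cast at this
        rw [eval_mul, this]; ring
      · rw [mZ2] at hi2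
        have := hψe i (by omega) (by omega)
        push_cast at this
        rw [this, hu, eval_mul, eval_mul]; ring
    rw [Finset.sum_congr rfl hterm, Finset.sum_eq_zero_iff_of_nonneg] at hsumz
    · apply hψ0
      rw [hu, wlp_zero_of_zeros T _ hcase.2 u hud, mul_zero]
      intro r hr
      have hr' := (mT r).1 hr
      have h1 := hsumz r.toNat (Finset.mem_range.2 (by omega))
      have e : ((r.toNat : ℕ) : ℚ) = (r : ℚ) := by
        have : ((r.toNat : ℕ) : ℤ) = r := by omega
        exact_mod_cast congrArg (Int.cast : ℤ → ℚ) this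
      rw [e] at h1
      have h2 := z1d r hr
      have h3 := z2d r hr
      simpa [h2.ne', h3.ne'] using h1
    · intro i hi
      have hi := Finset.mem_range.1 hi
      by_cases hi2 : (i : ℤ) ∈ Z2
      · have := z2b _ hi2
        push_cast at this
        rw [this]; simp
      · rw [mZ2] at hi2
        have hiT : (i : ℤ) ∈ T := (mT _).2 (by omega)
        have h2 := z1d _ hiT
        have h3 := z2d _ hiT
        push_cast at h2 h3
        positivity
  · -- use `F`
    obtain ⟨v', hv'd, hv'e⟩ : ∃ v' : ℚ[X], v'.degree < (p - Z1.card : ℕ) ∧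
        ∀ i ∈ T, v'.eval (i : ℚ) = v.eval (i : ℚ) := by
      by_cases h : q - Z2.card ≤ p - Z1.card
      · exact ⟨v, lt_of_lt_of_le hvd (by exact_mod_cast h), fun _ _ => rfl⟩
      · have hT : T.card ≤ p - Z1.card := by omega
        refine ⟨Lagrange.interpolate T (fun i : ℤ => (i : ℚ)) (fun i => v.eval (i : ℚ)),
          lt_of_lt_of_le (Lagrange.degree_interpolate_lt _ Int.cast_injective.injOn)
          (by exact_mod_cast hT), ?_⟩
        intro i hi
        exact Lagrange.eval_interpolate_at_node _ Int.cast_injective.injOn hi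
    have hsumz := wlp_pair_F α β (by omega) (by omega) d p F (z1 * v') (z1a p v' hv'd)
      (by
        intro i h1 h2 h3
        rw [eval_mul, z1b i ((mZ1 i).2 (by omega)), zero_mul])
      (fun m hm i hi => hF0 _ _ (by omega))
      (by
        intro m hm i h1 h2
        have := F1 (p - m - 1) i (by omega) (by omega) h1 (by omega)
        rwa [sub_add_cancel] at this)
    have hterm : ∀ i ∈ Finset.range (d + 1), F i p * (z1 * v').eval (i : ℚ) =
        z1.eval (i : ℚ) * z2.eval (i : ℚ) * v.eval (i : ℚ) ^ 2 := by
      intro i hi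
      have hi := Finset.mem_range.1 hi
      have e1 := hφe i (by omega) (by omega)
      push_cast at e1
      rw [e1, hv, eval_mul, eval_mul]
      by_cases hi2 : (i : ℤ) ∈ Z2
      · have := z2b _ hi2
        push_cast at this
        rw [this]; ring
      · rw [mZ2] at hi2
        have := hv'e i ((mT _).2 (by omega))
        push_cast at this
        rw [this]; ring
    rw [Finset.sum_congr rfl hterm, Finset.sum_eq_zero_iff_of_nonneg] at hsumz
    · apply hFp
      intro r
      by_cases hr' : 0 ≤ r ∧ r ≤ d ∧ d - b < r ∧ r < a
      · have hr := (mT r).2 hr'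
        have h1 := hsumz r.toNat (Finset.mem_range.2 (by omega))
        have e : ((r.toNat : ℕ) : ℚ) = (r : ℚ) := by
          have : ((r.toNat : ℕ) : ℤ) = r := by omega
          exact_mod_cast congrArg (Int.cast : ℤ → ℚ) this
        rw [e] at h1
        have h2 := z1d r hr
        have h3 := z2d r hr
        have h4 : v.eval (r : ℚ) = 0 := by simpa [h2.ne', h3.ne'] using h1
        rw [hφe r (by omega) (by omega), hv, eval_mul, h4, mul_zero]
      · exact hF0 _ _ (by omega)
    · intro i hi
      have hi := Finset.mem_range.1 hi
      by_cases hi2 : (i : ℤ) ∈ Z2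
      · have := z2b _ hi2
        push_cast at this
        rw [this]; simp
      · rw [mZ2] at hi2
        have hiT : (i : ℤ) ∈ T := (mT _).2 (by omega)
        have h2 := z1d _ hiT
        have h3 := z2d _ hiT
        push_cast at h2 h3
        positivity
end core2

section comb

/-- The order ideal generated by two exponents. -/
def wlpP (m1 m2 n : Fin 3 →₀ ℕ) : Prop := n ≤ m1 ∨ n ≤ m2

/-- Exponent vector with given entries at `x, y, z`. -/
noncomputable def wlpPt (x y z : Fin 3) (i k c : ℕ) : Fin 3 →₀ ℕ :=
  Finsupp.single x i + Finsupp.single y k + Finsupp.single z c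

/-- Extension by zero of a function on exponents to integer triples. -/
noncomputable def wlpG (x y z : Fin 3) (f : (Fin 3 →₀ ℕ) → ℚ) (i k c : ℤ) : ℚ :=
  if 0 ≤ i ∧ 0 ≤ k ∧ 0 ≤ c then f (wlpPt x y z i.toNat k.toNat c.toNat) else 0

lemma wlp_sum3 {M : Type*} [AddCommMonoid M] (x y z : Fin 3) (hxy : x ≠ y) (hxz : x ≠ z)
    (hyz : y ≠ z) (f : Fin 3 → M) : ∑ v, f v = f x + f y + f z := by
  have : (Finset.univ : Finset (Fin 3)) = {x, y, z} := by
    revert x y z; decide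
  rw [this, Finset.sum_insert (by simp [hxy, hxz]), Finset.sum_insert (by simp [hyz]),
    Finset.sum_singleton, add_assoc]

lemma wlp_all3 (x y z : Fin 3) (hxy : x ≠ y) (hxz : x ≠ z)
    (hyz : y ≠ z) (v : Fin 3) : v = x ∨ v = y ∨ v = z := by
  revert x y z v; decide

lemma wlp_degree (n : Fin 3 →₀ ℕ) : n.degree = ∑ v, n v := by
  rw [Finsupp.degree_eq_sum]

lemma wlp_oriented (m1 m2 : Fin 3 →₀ ℕ) (hdeg : m1.degree = m2.degree) (j : ℕ)
    (x y z : Fin 3) (hxy : x ≠ y) (hxz : x ≠ z) (hyz : y ≠ z) (hx : m2 x ≤ m1 x) (hy : m2 y ≤ m1 y)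
    (f F : (Fin 3 →₀ ℕ) → ℚ)
    (hf0 : ∀ n, ¬ (wlpP m1 m2 n ∧ n.degree = j) → f n = 0)
    (hF0 : ∀ n, ¬ (wlpP m1 m2 n ∧ n.degree = j + 1) → F n = 0)
    (hf : ∀ m, wlpP m1 m2 m → m.degree = j + 1 →
      ∑ v, (if m v = 0 then 0 else f (m - Finsupp.single v 1)) = 0)
    (hF : ∀ n, wlpP m1 m2 n → n.degree = j → ∑ v, F (n + Finsupp.single v 1) = 0) :
    (∀ n, f n = 0) ∨ (∀ n, F n = 0) := by
  have hall := wlp_all3 x y z hxy hxz hyz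
  have ex : ∀ i k c, wlpPt x y z i k c x = i := by
    intro i k c; simp [wlpPt, hxy, hxz]
  have ey : ∀ i k c, wlpPt x y z i k c y = k := by
    intro i k c; simp [wlpPt, hxy.symm, hyz]
  have ez : ∀ i k c, wlpPt x y z i k c z = c := by
    intro i k c; simp [wlpPt, hxz.symm, hyz.symm]
  have ext3 : ∀ n n' : Fin 3 →₀ ℕ, n x = n' x → n y = n' y → n z = n' z → n = n' := by
    intro n n' h1 h2 h3
    ext v
    rcases hall v with rfl | rfl | rfl <;> assumption
  have le3 : ∀ n n' : Fin 3 →₀ ℕ, n ≤ n' ↔ n x ≤ n' x ∧ n y ≤ n' y ∧ n z ≤ n' z := by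
    intro n n'
    rw [Finsupp.le_def]
    refine ⟨fun h => ⟨h x, h y, h z⟩, fun h v => ?_⟩
    rcases hall v with rfl | rfl | rfl <;> omega
  have dg : ∀ n : Fin 3 →₀ ℕ, n.degree = n x + n y + n z := by
    intro n
    rw [wlp_degree, wlp_sum3 x y z hxy hxz hyz]
  have hd := hdeg
  rw [dg, dg] at hd
  have regP : ∀ i k c : ℤ, wlpReg (m1 x + 1 : ℕ) (m1 y + 1 : ℕ) (m2 x + 1 : ℕ) (m2 y + 1 : ℕ)
      (m1 z + 1 : ℕ) (m2 z - m1 z : ℕ) i k c ↔ 0 ≤ i ∧ 0 ≤ k ∧ 0 ≤ c ∧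
        wlpP m1 m2 (wlpPt x y z i.toNat k.toNat c.toNat) := by
    intro i k c
    unfold wlpP wlpReg
    rw [le3, le3, ex, ey, ez]
    omega
  have gz : ∀ (N : ℕ) (g : (Fin 3 →₀ ℕ) → ℚ), (∀ n, ¬ (wlpP m1 m2 n ∧ n.degree = N) → g n = 0) →
      (∀ i c : ℤ, wlpG x y z g i (N - i - c) c = 0) → ∀ n, g n = 0 := by
    intro N g hg h n
    by_cases hn : n.degree = N
    · have := h (n x) (n z)
      rw [dg] at hn
      rw [wlpG, if_pos (by omega)] at this
      rw [← this]
      congr 1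
      apply ext3
      · rw [ex]; omega
      · rw [ey]; omega
      · rw [ez]; omega
    · exact hg n (by tauto)
  have g0 : ∀ (N : ℤ) (g : (Fin 3 →₀ ℕ) → ℚ), (∀ n, ¬ (wlpP m1 m2 n ∧ n.degree = N) → g n = 0) →
      ∀ i c : ℤ, ¬ wlpReg (m1 x + 1 : ℕ) (m1 y + 1 : ℕ) (m2 x + 1 : ℕ) (m2 y + 1 : ℕ)
      (m1 z + 1 : ℕ) (m2 z - m1 z : ℕ) i (N - i - c) c → wlpG x y z g i (N - i - c) c = 0 := by
    intro N g hg i c hr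
    unfold wlpG
    split_ifs with h
    · apply hg
      rw [regP] at hr
      tauto
    · rfl
  have sgn : ∀ i : ℤ, ((-1 : ℚ)) ^ (i - 1) = - (-1) ^ i := by
    intro i; rw [zpow_sub_one₀ (by norm_num)]; norm_num
  have sgn2 : ∀ i : ℤ, ((-1 : ℚ)) ^ (i + 1) = - (-1) ^ i := by
    intro i; rw [zpow_add_one₀ (by norm_num)]; norm_num
  have sgn0 : ∀ i : ℤ, ((-1 : ℚ)) ^ i ≠ 0 := fun i => zpow_ne_zero _ (by norm_num)
  have core := wlp_core (m1 x + 1 : ℕ) (m1 y + 1 : ℕ) (m2 x + 1 : ℕ) (m2 y + 1 : ℕ) j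
      (m1 z + 1 : ℕ) (m2 z - m1 z : ℕ) (by omega) (by omega) (by omega) (by omega) (by omega)
      (fun i c => (-1) ^ i * wlpG x y z f i (j - i - c) c)
      (fun i c => (-1) ^ i * wlpG x y z F i (j + 1 - i - c) c)
      (by
        intro i c h
        simp only [g0 j f (by exact_mod_cast hf0) i c h, mul_zero])
      (by
        intro i c h
        simp only [g0 (j + 1) F (by exact_mod_cast hF0) i c h, mul_zero])
      (by
        intro i c h
        rw [regP] at h
        obtain ⟨h1, h2, h3, h4⟩ := h
        obtain ⟨k, hk⟩ : ∃ k : ℤ, k = j + 1 - i - c := ⟨_, rfl⟩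
        have e1 : (j : ℤ) - i - (c - 1) = k := by omega
        have e2 : (j : ℤ) - (i - 1) - c = k := by omega
        have e3 : (j : ℤ) - i - c = k - 1 := by omega
        rw [← hk] at h2 h4
        simp only [e1, e2, e3, sgn]
        have := hf _ h4 (by rw [dg, ex, ey, ez]; omega)
        rw [wlp_sum3 x y z hxy hxz hyz, ex, ey, ez] at this
        have t1 : (if i.toNat = 0 then 0 else f (wlpPt x y z i.toNat k.toNat c.toNat -
            Finsupp.single x 1)) = wlpG x y z f (i - 1) k c := by
          unfold wlpG
          split_ifs with h5 h6 h7
          · omega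
          · rfl
          · congr 1
            apply ext3
            · rw [ex, Finsupp.tsub_apply, ex, Finsupp.single_eq_same]; omega
            · rw [ey, Finsupp.tsub_apply, ey, Finsupp.single_eq_of_ne hxy.symm]; omega
            · rw [ez, Finsupp.tsub_apply, ez, Finsupp.single_eq_of_ne hxz.symm]; omega
          · omega
        have t2 : (if k.toNat = 0 then 0 else f (wlpPt x y z i.toNat k.toNat c.toNat -
            Finsupp.single y 1)) = wlpG x y z f i (k - 1) c := by
          unfold wlpG
          split_ifs with h5 h6 h7
          · omega
          · rfl
          · congr 1
            apply ext3
            · rw [ex, Finsupp.tsub_apply, ex, Finsupp.single_eq_of_ne hxy]; omega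
            · rw [ey, Finsupp.tsub_apply, ey, Finsupp.single_eq_same]; omega
            · rw [ez, Finsupp.tsub_apply, ez, Finsupp.single_eq_of_ne hyz.symm]; omega
          · omega
        have t3 : (if c.toNat = 0 then 0 else f (wlpPt x y z i.toNat k.toNat c.toNat -
            Finsupp.single z 1)) = wlpG x y z f i k (c - 1) := by
          unfold wlpG
          split_ifs with h5 h6 h7
          · omega
          · rfl
          · congr 1
            apply ext3
            · rw [ex, Finsupp.tsub_apply, ex, Finsupp.single_eq_of_ne hxz]; omega
            · rw [ey, Finsupp.tsub_apply, ey, Finsupp.single_eq_of_ne hyz]; omega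
            · rw [ez, Finsupp.tsub_apply, ez, Finsupp.single_eq_same]; omega
          · omega
        rw [t1, t2, t3] at this
        linear_combination ((-1 : ℚ) ^ i) * this)
      (by
        intro i c h
        rw [regP] at h
        obtain ⟨h1, h2, h3, h4⟩ := h
        obtain ⟨k, hk⟩ : ∃ k : ℤ, k = j - i - c := ⟨_, rfl⟩
        have e1 : (j : ℤ) + 1 - i - (c + 1) = k := by omega
        have e2 : (j : ℤ) + 1 - (i + 1) - c = k := by omega
        have e3 : (j : ℤ) + 1 - i - c = k + 1 := by omega
        rw [← hk] at h2 h4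
        simp only [e1, e2, e3, sgn2]
        have := hF _ h4 (by rw [dg, ex, ey, ez]; omega)
        rw [wlp_sum3 x y z hxy hxz hyz] at this
        have t1 : F (wlpPt x y z i.toNat k.toNat c.toNat +
            Finsupp.single x 1) = wlpG x y z F (i + 1) k c := by
          unfold wlpG
          rw [if_pos (by omega)]
          congr 1
          apply ext3
          · rw [ex, Finsupp.add_apply, ex, Finsupp.single_eq_same]; omega
          · rw [ey, Finsupp.add_apply, ey, Finsupp.single_eq_of_ne hxy.symm]; omega
          · rw [ez, Finsupp.add_apply, ez, Finsupp.single_eq_of_ne hxz.symm]; omega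
        have t2 : F (wlpPt x y z i.toNat k.toNat c.toNat +
            Finsupp.single y 1) = wlpG x y z F i (k + 1) c := by
          unfold wlpG
          rw [if_pos (by omega)]
          congr 1
          apply ext3
          · rw [ex, Finsupp.add_apply, ex, Finsupp.single_eq_of_ne hxy]; omega
          · rw [ey, Finsupp.add_apply, ey, Finsupp.single_eq_same]; omega
          · rw [ez, Finsupp.add_apply, ez, Finsupp.single_eq_of_ne hyz.symm]; omega
        have t3 : F (wlpPt x y z i.toNat k.toNat c.toNat +
            Finsupp.single z 1) = wlpG x y z F i k (c + 1) := by
          unfold wlpG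
          rw [if_pos (by omega)]
          congr 1
          apply ext3
          · rw [ex, Finsupp.add_apply, ex, Finsupp.single_eq_of_ne hxz]; omega
          · rw [ey, Finsupp.add_apply, ey, Finsupp.single_eq_of_ne hyz]; omega
          · rw [ez, Finsupp.add_apply, ez, Finsupp.single_eq_same]; omega
        rw [t1, t2, t3] at this
        linear_combination ((-1 : ℚ) ^ i) * this)
  rcases core with h | h
  · left
    refine gz j f hf0 fun i c => ?_
    exact (mul_eq_zero.1 (h i c)).resolve_left (sgn0 i)
  · right
    refine gz (j + 1) F hF0 fun i c => ?_
    push_cast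
    exact (mul_eq_zero.1 (h i c)).resolve_left (sgn0 i)

lemma wlp_comb (m1 m2 : Fin 3 →₀ ℕ) (hdeg : m1.degree = m2.degree) (j : ℕ)
    (f F : (Fin 3 →₀ ℕ) → ℚ)
    (hf0 : ∀ n, ¬ (wlpP m1 m2 n ∧ n.degree = j) → f n = 0)
    (hF0 : ∀ n, ¬ (wlpP m1 m2 n ∧ n.degree = j + 1) → F n = 0)
    (hf : ∀ m, wlpP m1 m2 m → m.degree = j + 1 →
      ∑ v, (if m v = 0 then 0 else f (m - Finsupp.single v 1)) = 0)
    (hF : ∀ n, wlpP m1 m2 n → n.degree = j → ∑ v, F (n + Finsupp.single v 1) = 0) :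
    (∀ n, f n = 0) ∨ (∀ n, F n = 0) := by
  have sw : ∀ n, wlpP m1 m2 n ↔ wlpP m2 m1 n := fun n => or_comm
  have key : ∀ x y z : Fin 3, x ≠ y → x ≠ z → y ≠ z →
      ((m2 x ≤ m1 x ∧ m2 y ≤ m1 y) ∨ (m1 x ≤ m2 x ∧ m1 y ≤ m2 y)) →
      (∀ n, f n = 0) ∨ (∀ n, F n = 0) := by
    intro x y z hxy hxz hyz h
    rcases h with h | h
    · exact wlp_oriented m1 m2 hdeg j x y z hxy hxz hyz h.1 h.2 f F hf0 hF0 hf hF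
    · simp only [sw] at hf0 hF0 hf hF
      exact wlp_oriented m2 m1 hdeg.symm j x y z hxy hxz hyz h.1 h.2 f F hf0 hF0 hf hF
  have h01 := key 0 1 2 (by decide) (by decide) (by decide)
  have h02 := key 0 2 1 (by decide) (by decide) (by decide)
  have h12 := key 1 2 0 (by decide) (by decide) (by decide)
  rcases le_total (m1 0) (m2 0) with a | a <;> rcases le_total (m1 1) (m2 1) with b | b <;>
    rcases le_total (m1 2) (m2 2) with c | c <;> tauto
end comb

section matrix
open Matrix

lemma wlp_left_inv {m n : Type*} [Fintype m] [Fintype n] [DecidableEq m] [DecidableEq n]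
    (M : Matrix m n ℚ) (h : ∀ f, M *ᵥ f = 0 → f = 0) : ∃ N : Matrix n m ℚ, N * M = 1 := by
  have hk : LinearMap.ker (Matrix.toLin' M) = ⊥ := by
    rw [LinearMap.ker_eq_bot']
    intro f hf
    exact h f (by simpa using hf)
  obtain ⟨g, hg⟩ := LinearMap.exists_leftInverse_of_injective _ hk
  refine ⟨LinearMap.toMatrix' g, ?_⟩
  have := congrArg LinearMap.toMatrix' hg
  rwa [LinearMap.toMatrix'_comp, LinearMap.toMatrix'_toLin', LinearMap.toMatrix'_id] at this

lemma wlp_right_inv {m n : Type*} [Fintype m] [Fintype n] [DecidableEq m] [DecidableEq n]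
    (M : Matrix m n ℚ) (h : ∀ F, F ᵥ* M = 0 → F = 0) : ∃ N : Matrix n m ℚ, M * N = 1 := by
  obtain ⟨N, hN⟩ := wlp_left_inv Mᵀ (fun f hf => h f (by rwa [mulVec_transpose] at hf))
  refine ⟨Nᵀ, ?_⟩
  have := congrArg Matrix.transpose hN
  rwa [transpose_mul, transpose_transpose, transpose_one] at this

/-- exponents of the order ideal in degree `j` -/
abbrev wlpJ (m1 m2 : Fin 3 →₀ ℕ) (j : ℕ) : Type :=
  {n : Fin 3 →₀ ℕ // wlpP m1 m2 n ∧ n.degree = j}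

noncomputable instance wlpJ_fintype (m1 m2 : Fin 3 →₀ ℕ) (j : ℕ) : Fintype (wlpJ m1 m2 j) := by
  have h : Set.Finite {n : Fin 3 →₀ ℕ | wlpP m1 m2 n ∧ n.degree = j} := by
    refine Set.Finite.subset ((Set.finite_Iic m1).union (Set.finite_Iic m2)) ?_
    rintro n ⟨hn | hn, -⟩
    · exact Or.inl hn
    · exact Or.inr hn
  exact h.fintype

/-- multiplication matrix -/
noncomputable def wlpM (R : Type*) [CommRing R] (m1 m2 : Fin 3 →₀ ℕ) (j : ℕ) :
    Matrix (wlpJ m1 m2 (j + 1)) (wlpJ m1 m2 j) R :=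
  fun m n => ∑ v, if n.1 + Finsupp.single v 1 = m.1 then 1 else 0

lemma wlpP_mono {m1 m2 n n' : Fin 3 →₀ ℕ} (h : n ≤ n') (hn : wlpP m1 m2 n') : wlpP m1 m2 n :=
  hn.imp h.trans h.trans

lemma wlpM_mulVec (R : Type*) [CommRing R] (m1 m2 : Fin 3 →₀ ℕ) (j : ℕ)
    (f : (Fin 3 →₀ ℕ) → R) (m : wlpJ m1 m2 (j + 1)) :
    (wlpM R m1 m2 j *ᵥ fun n => f n.1) m =
      ∑ v, (if m.1 v = 0 then 0 else f (m.1 - Finsupp.single v 1)) := by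
  simp only [mulVec, dotProduct, wlpM, Finset.sum_mul]
  rw [Finset.sum_comm]
  refine Finset.sum_congr rfl fun v _ => ?_
  split_ifs with h
  · refine Finset.sum_eq_zero fun n _ => ?_
    rw [if_neg, zero_mul]
    intro e
    rw [← e] at h
    simp at h
  · have hle : Finsupp.single v 1 ≤ m.1 := by
      rw [Finsupp.single_le_iff]; omega
    have hs : m.1 - Finsupp.single v 1 + Finsupp.single v 1 = m.1 := tsub_add_cancel_of_le hle
    have hP : wlpP m1 m2 (m.1 - Finsupp.single v 1) ∧ (m.1 - Finsupp.single v 1).degree = j := by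
      refine ⟨wlpP_mono tsub_le_self m.2.1, ?_⟩
      have := congrArg Finsupp.degree hs
      rw [map_add, m.2.2, Finsupp.degree_single] at this
      omega
    rw [Finset.sum_eq_single ⟨_, hP⟩]
    · simp [hs]
    · intro n _ hn
      rw [if_neg, zero_mul]
      intro e
      apply hn
      ext1
      simp [← e]
    · simp

lemma wlpM_vecMul (R : Type*) [CommRing R] (m1 m2 : Fin 3 →₀ ℕ) (j : ℕ)
    (F : (Fin 3 →₀ ℕ) → R) (hF0 : ∀ n, ¬ (wlpP m1 m2 n ∧ n.degree = j + 1) → F n = 0)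
    (n : wlpJ m1 m2 j) :
    ((fun m : wlpJ m1 m2 (j + 1) => F m.1) ᵥ* wlpM R m1 m2 j) n =
      ∑ v, F (n.1 + Finsupp.single v 1) := by
  simp only [vecMul, dotProduct, wlpM, Finset.mul_sum]
  rw [Finset.sum_comm]
  refine Finset.sum_congr rfl fun v _ => ?_
  by_cases h : wlpP m1 m2 (n.1 + Finsupp.single v 1) ∧ (n.1 + Finsupp.single v 1).degree = j + 1
  · rw [Finset.sum_eq_single ⟨_, h⟩]
    · simp
    · intro m _ hm
      rw [if_neg, mul_zero]
      intro e
      apply hm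
      ext1
      exact e.symm
    · simp
  · rw [hF0 _ h]
    refine Finset.sum_eq_zero fun m _ => ?_
    rw [if_neg, mul_zero]
    intro e
    rw [e] at h
    exact h m.2

lemma wlp_matrix (m1 m2 : Fin 3 →₀ ℕ) (hdeg : m1.degree = m2.degree) (j : ℕ) :
    (∃ N : Matrix (wlpJ m1 m2 j) (wlpJ m1 m2 (j + 1)) ℚ, N * wlpM ℚ m1 m2 j = 1) ∨
    (∃ N : Matrix (wlpJ m1 m2 j) (wlpJ m1 m2 (j + 1)) ℚ, wlpM ℚ m1 m2 j * N = 1) := by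
  classical
  by_contra hcon
  rw [not_or] at hcon
  have h1 : ¬ ∀ f, wlpM ℚ m1 m2 j *ᵥ f = 0 → f = 0 := fun h => hcon.1 (wlp_left_inv _ h)
  have h2 : ¬ ∀ F, F ᵥ* wlpM ℚ m1 m2 j = 0 → F = 0 := fun h => hcon.2 (wlp_right_inv _ h)
  push Not at h1 h2
  obtain ⟨f, hf, hfne⟩ := h1
  obtain ⟨F, hF, hFne⟩ := h2
  let f' : (Fin 3 →₀ ℕ) → ℚ := fun n => if h : wlpP m1 m2 n ∧ n.degree = j then f ⟨n, h⟩ else 0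
  let F' : (Fin 3 →₀ ℕ) → ℚ :=
    fun n => if h : wlpP m1 m2 n ∧ n.degree = j + 1 then F ⟨n, h⟩ else 0
  have ef : f = fun n => f' n.1 := by
    funext n; simp only [f']; rw [dif_pos n.2]
  have eF : F = fun n => F' n.1 := by
    funext n; simp only [F']; rw [dif_pos n.2]
  have hF0 : ∀ n, ¬ (wlpP m1 m2 n ∧ n.degree = j + 1) → F' n = 0 := fun n h => dif_neg h
  rcases wlp_comb m1 m2 hdeg j f' F' (fun n h => dif_neg h) hF0
    (by
      intro m hm hm2
      have := congrFun hf ⟨m, hm, hm2⟩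
      rw [ef, wlpM_mulVec] at this
      exact this)
    (by
      intro n hn hn2
      have := congrFun hF ⟨n, hn, hn2⟩
      rw [eF, wlpM_vecMul _ _ _ _ _ hF0] at this
      exact this) with h | h
  · apply hfne; rw [ef]; funext n; exact h _
  · apply hFne; rw [eF]; funext n; exact h _

lemma wlp_matrix_field (k : Type*) [Field k] [CharZero k]
    (m1 m2 : Fin 3 →₀ ℕ) (hdeg : m1.degree = m2.degree) (j : ℕ) :
    (∃ N : Matrix (wlpJ m1 m2 j) (wlpJ m1 m2 (j + 1)) k, N * wlpM k m1 m2 j = 1) ∨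
    (∃ N : Matrix (wlpJ m1 m2 j) (wlpJ m1 m2 (j + 1)) k, wlpM k m1 m2 j * N = 1) := by
  have e : (wlpM ℚ m1 m2 j).map (algebraMap ℚ k) = wlpM k m1 m2 j := by
    ext m n
    simp only [wlpM, map_apply, map_sum]
    refine Finset.sum_congr rfl fun v _ => ?_
    split_ifs <;> simp
  rcases wlp_matrix m1 m2 hdeg j with ⟨N, hN⟩ | ⟨N, hN⟩
  · left
    refine ⟨N.map (algebraMap ℚ k), ?_⟩
    rw [← e, ← Matrix.map_mul, hN, Matrix.map_one _ (map_zero _) (map_one _)]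
  · right
    refine ⟨N.map (algebraMap ℚ k), ?_⟩
    rw [← e, ← Matrix.map_mul, hN, Matrix.map_one _ (map_zero _) (map_one _)]
end matrix

section final
open MvPolynomial Matrix

lemma wlp_coeff_L {k : Type*} [Field k] (p : MvPolynomial (Fin 3) k) (m : Fin 3 →₀ ℕ) :
    coeff m ((∑ v, X v) * p) = ∑ v, (if m v = 0 then 0 else coeff (m - Finsupp.single v 1) p) := by
  rw [Finset.sum_mul, coeff_sum]
  refine Finset.sum_congr rfl fun v _ => ?_
  rw [coeff_X_mul']
  by_cases h : m v = 0 <;> simp [h]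

lemma wlp_final (k : Type*) [Field k] [CharZero k] (I : Ideal (MvPolynomial (Fin 3) k))
    (m1 m2 : Fin 3 →₀ ℕ) (hdeg : m1.degree = m2.degree)
    (hI : ∀ p, p ∈ I ↔ ∀ n ∈ p.support, ¬ wlpP m1 m2 n) :
    ∃ L ∈ homogeneousSubmodule (Fin 3) k 1,
      ∀ j : ℕ,
        (∀ a ∈ (homogeneousSubmodule (Fin 3) k j).map
            (Ideal.Quotient.mkₐ k I).toLinearMap,
          Ideal.Quotient.mk I L * a = 0 → a = 0) ∨
        (∀ b ∈ (homogeneousSubmodule (Fin 3) k (j + 1)).map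
            (Ideal.Quotient.mkₐ k I).toLinearMap,
          ∃ a ∈ (homogeneousSubmodule (Fin 3) k j).map
              (Ideal.Quotient.mkₐ k I).toLinearMap,
            Ideal.Quotient.mk I L * a = b) := by
  classical
  have hL : (∑ v, X v : MvPolynomial (Fin 3) k) ∈ homogeneousSubmodule (Fin 3) k 1 :=
    Submodule.sum_mem _ fun v _ => isHomogeneous_X k v
  refine ⟨∑ v, X v, hL, fun j => ?_⟩
  have hI' : ∀ p, p ∈ I ↔ ∀ n, wlpP m1 m2 n → coeff n p = 0 := by
    intro p
    rw [hI]
    refine forall_congr' fun n => ?_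
    rw [mem_support_iff]
    tauto
  rcases wlp_matrix_field k m1 m2 hdeg j with ⟨N, hN⟩ | ⟨N, hN⟩
  · left
    rintro _ ⟨p, hp, rfl⟩ h
    replace h : Ideal.Quotient.mk I ((∑ v, X v) * p) = 0 := by rw [map_mul]; exact h
    rw [Ideal.Quotient.eq_zero_iff_mem, hI'] at h
    change Ideal.Quotient.mk I p = 0
    rw [Ideal.Quotient.eq_zero_iff_mem, hI']
    have h0 : wlpM k m1 m2 j *ᵥ (fun n => coeff n.1 p) = 0 := by
      funext m
      rw [wlpM_mulVec k m1 m2 j (fun n => coeff n p), ← wlp_coeff_L]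
      exact h _ m.2.1
    have h1 : (fun n : wlpJ m1 m2 j => coeff n.1 p) = 0 := by
      have := congrArg (N *ᵥ ·) h0
      simpa [hN] using this
    intro n hn
    by_cases hnj : n.degree = j
    · exact congrFun h1 ⟨n, hn, hnj⟩
    · exact IsHomogeneous.coeff_eq_zero hp hnj
  · right
    rintro _ ⟨q, hq, rfl⟩
    let w : wlpJ m1 m2 j → k := N *ᵥ fun m => coeff m.1 q
    let p : MvPolynomial (Fin 3) k := ∑ n, monomial n.1 (w n)
    have hp : p ∈ homogeneousSubmodule (Fin 3) k j :=
      Submodule.sum_mem _ fun n _ => isHomogeneous_monomial _ n.2.2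
    have hw : w = fun n => coeff n.1 p := by
      funext n
      simp only [p, coeff_sum, coeff_monomial]
      rw [Finset.sum_eq_single n]
      · simp
      · intro n' _ hne
        rw [if_neg]
        intro e
        exact hne (Subtype.ext e)
      · simp
    refine ⟨_, ⟨p, hp, rfl⟩, ?_⟩
    change Ideal.Quotient.mk I (∑ v, X v) * Ideal.Quotient.mk I p = Ideal.Quotient.mk I q
    rw [← map_mul, Ideal.Quotient.eq, hI']
    intro m hm
    by_cases hmj : m.degree = j + 1
    · have h1 : wlpM k m1 m2 j *ᵥ w = fun m => coeff m.1 q := by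
        simp only [w, mulVec_mulVec, hN, one_mulVec]
      have h2 := congrFun h1 ⟨m, hm, hmj⟩
      rw [hw, wlpM_mulVec k m1 m2 j (fun n => coeff n p), ← wlp_coeff_L] at h2
      rw [coeff_sub, h2, sub_self]
    · have h3 : ((∑ v, X v) * p).IsHomogeneous (j + 1) := by
        rw [add_comm j 1]
        exact IsHomogeneous.mul hL hp
      rw [coeff_sub, h3.coeff_eq_zero hmj, IsHomogeneous.coeff_eq_zero hq hmj, sub_zero]

lemma wlp_inj3 {α : Type*} (x y z : α) (hxy : x ≠ y) (hxz : x ≠ z) (hyz : y ≠ z) :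
    Function.Injective ![x, y, z] := by
  intro i i' h
  match i, i' with
  | 0, 0 => rfl
  | 0, 1 => exact absurd h hxy
  | 0, 2 => exact absurd h hxz
  | 1, 0 => exact absurd h hxy.symm
  | 1, 1 => rfl
  | 1, 2 => exact absurd h hyz
  | 2, 0 => exact absurd h hxz.symm
  | 2, 1 => exact absurd h hyz.symm
  | 2, 2 => rfl

theorem wlp_main
    (k : Type*) [Field k] [CharZero k]
    (I : Ideal (MvPolynomial (Fin 3) k))
    (hmono : ∃ G : Set (Fin 3 →₀ ℕ),
      I = Ideal.span ((fun d => (monomial d (1 : k))) '' G))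
    (hart : FiniteDimensional k (MvPolynomial (Fin 3) k ⧸ I))
    (socle : Submodule k (MvPolynomial (Fin 3) k ⧸ I))
    (hsocle : ∀ a : MvPolynomial (Fin 3) k ⧸ I,
      a ∈ socle ↔ ∀ i : Fin 3, Ideal.Quotient.mk I (X i) * a = 0)
    (e : ℕ)
    (htype2 : Module.finrank k socle = 2)
    (hlevel : ∀ a ∈ socle,
      a ∈ (homogeneousSubmodule (Fin 3) k e).map (Ideal.Quotient.mkₐ k I).toLinearMap) :
    ∃ m1 m2 : Fin 3 →₀ ℕ, m1.degree = m2.degree ∧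
      ∀ p, p ∈ I ↔ ∀ n ∈ p.support, ¬ wlpP m1 m2 n := by
  classical
  obtain ⟨G, hG⟩ := hmono
  let P : Set (Fin 3 →₀ ℕ) := {n | ∀ g ∈ G, ¬ g ≤ n}
  have hI : ∀ p, p ∈ I ↔ ∀ n ∈ p.support, n ∉ P := by
    intro p
    rw [hG, mem_ideal_span_monomial_image]
    simp [P]
  have hdown : ∀ n n', n ≤ n' → n' ∈ P → n ∈ P := fun n n' h h' g hg hgn => h' g hg (hgn.trans h)
  -- monomials outside `I` are independent
  have hli : LinearIndependent k (fun n : P => Ideal.Quotient.mk I (monomial n.1 (1 : k))) := by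
    rw [linearIndependent_iff']
    intro s g hg n hn
    have h1 : Ideal.Quotient.mk I (∑ i ∈ s, monomial i.1 (g i)) = 0 := by
      rw [← hg, map_sum]
      refine Finset.sum_congr rfl fun i _ => ?_
      rw [show monomial i.1 (g i) = g i • monomial i.1 (1 : k) by simp [smul_monomial]]
      rfl
    rw [Ideal.Quotient.eq_zero_iff_mem, hI] at h1
    have h2 : coeff n.1 (∑ i ∈ s, monomial i.1 (g i)) = g n := by
      rw [coeff_sum, Finset.sum_eq_single n]
      · simp
      · intro b _ hb
        rw [coeff_monomial, if_neg (fun h => hb (Subtype.ext h))]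
      · exact fun h => absurd hn h
    by_contra hne
    exact h1 n.1 (by rw [mem_support_iff, h2]; exact hne) n.2
  have hPfin : P.Finite := by
    have := hli.finite
    exact Set.toFinite P
  -- maximal elements give socle elements
  have hsoc : ∀ n, Maximal (· ∈ P) n → Ideal.Quotient.mk I (monomial n (1 : k)) ∈ socle := by
    intro n hn
    rw [hsocle]
    intro i
    rw [← map_mul, Ideal.Quotient.eq_zero_iff_mem, hI]
    intro m hm hmP
    rw [X, monomial_mul] at hm
    have : m = Finsupp.single i 1 + n := by
      have := support_monomial_subset hm
      simpa using this
    have h2 := hn.2 hmP (by rw [this]; exact le_add_self)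
    have h3 := h2 i
    rw [this] at h3
    simp at h3
  have hmaxdeg : ∀ n, Maximal (· ∈ P) n → n.degree = e := by
    intro n hn
    obtain ⟨p, hp, hpe⟩ := hlevel _ (hsoc n hn)
    have h1 : monomial n (1 : k) - p ∈ I := by
      rw [← Ideal.Quotient.eq]; exact hpe.symm
    by_contra hne
    rw [hI] at h1
    refine h1 n ?_ hn.1
    rw [mem_support_iff, coeff_sub, IsHomogeneous.coeff_eq_zero hp hne]
    simp
  have hthree : ∀ x y z, Maximal (· ∈ P) x → Maximal (· ∈ P) y → Maximal (· ∈ P) z →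
      x ≠ y → x ≠ z → y ≠ z → False := by
    intro x y z hx hy hz hxy hxz hyz
    let t : Fin 3 → P := ![⟨x, hx.1⟩, ⟨y, hy.1⟩, ⟨z, hz.1⟩]
    have hmaxt : ∀ i, Maximal (· ∈ P) (t i).1 := by
      intro i
      match i with
      | 0 => exact hx
      | 1 => exact hy
      | 2 => exact hz
    have htinj : Function.Injective t :=
      wlp_inj3 _ _ _ (fun h => hxy (congrArg Subtype.val h))
        (fun h => hxz (congrArg Subtype.val h)) (fun h => hyz (congrArg Subtype.val h))
    have hl := hli.comp t htinj
    have hl2 : LinearIndependent k (fun i : Fin 3 =>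
        (⟨_, hsoc _ (hmaxt i)⟩ : socle)) := by
      apply LinearIndependent.of_comp socle.subtype
      exact hl
    have : FiniteDimensional k socle := inferInstance
    have := hl2.fintype_card_le_finrank
    rw [htype2] at this
    simp at this
  have hne : P.Nonempty := by
    by_contra hempty
    rw [Set.not_nonempty_iff_eq_empty] at hempty
    have htop : ∀ a : MvPolynomial (Fin 3) k ⧸ I, a = 0 := by
      intro a
      obtain ⟨p, rfl⟩ := Ideal.Quotient.mk_surjective a
      rw [Ideal.Quotient.eq_zero_iff_mem, hI]
      simp [hempty]
    have : Subsingleton socle := ⟨fun a b => Subtype.ext ((htop _).trans (htop _).symm)⟩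
    rw [Module.finrank_zero_of_subsingleton] at htype2
    omega
  have hmaxex : ∀ n ∈ P, ∃ m, n ≤ m ∧ Maximal (· ∈ P) m := fun n hn => hPfin.exists_le_maximal hn
  obtain ⟨n0, hn0⟩ := hne
  obtain ⟨m1, -, hm1⟩ := hmaxex n0 hn0
  obtain ⟨m2, hm2, hcov⟩ : ∃ m2, Maximal (· ∈ P) m2 ∧ ∀ m, Maximal (· ∈ P) m → m = m1 ∨ m = m2 := by
    by_cases h : ∃ m2, Maximal (· ∈ P) m2 ∧ m2 ≠ m1
    · obtain ⟨m2, h2, h21⟩ := h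
      refine ⟨m2, h2, fun m hm => ?_⟩
      by_contra hc
      rw [not_or] at hc
      exact hthree m m1 m2 hm hm1 h2 hc.1 hc.2 h21.symm
    · push Not at h
      exact ⟨m1, hm1, fun m hm => Or.inl (h m hm)⟩
  refine ⟨m1, m2, by rw [hmaxdeg _ hm1, hmaxdeg _ hm2], ?_⟩
  have hPP : ∀ n, n ∈ P ↔ wlpP m1 m2 n := by
    intro n
    constructor
    · intro hn
      obtain ⟨m, hnm, hm⟩ := hmaxex n hn
      rcases hcov m hm with rfl | rfl
      · exact Or.inl hnm
      · exact Or.inr hnm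
    · rintro (h | h)
      · exact hdown _ _ h hm1.1
      · exact hdown _ _ h hm2.1
  intro p
  rw [hI]
  simp only [hPP]
end final


open MvPolynomial

/-- Let `k` be a field of characteristic zero, `R = k[x,y,z]`, and let
`I ⊂ R` be a monomial ideal such that `A = R/I` is Artinian and level of type 2 (its
socle is a 2-dimensional `k`-vector space contained in a single graded component `A_e`).
Then `A` has the Weak Lefschetz Property: there is a linear form `L` such that for every
`j ≥ 0` the multiplication map `×L : A_j → A_{j+1}` is injective or surjective. -/
theorem monomial_level_type_two_three_vars_WLP
    (k : Type*) [Field k] [CharZero k]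
    (I : Ideal (MvPolynomial (Fin 3) k))
    (hmono : ∃ G : Set (Fin 3 →₀ ℕ),
      I = Ideal.span ((fun d => (monomial d (1 : k))) '' G))
    (hart : FiniteDimensional k (MvPolynomial (Fin 3) k ⧸ I))
    (socle : Submodule k (MvPolynomial (Fin 3) k ⧸ I))
    (hsocle : ∀ a : MvPolynomial (Fin 3) k ⧸ I,
      a ∈ socle ↔ ∀ i : Fin 3, Ideal.Quotient.mk I (X i) * a = 0)
    (e : ℕ)
    (htype2 : Module.finrank k socle = 2)
    (hlevel : ∀ a ∈ socle,
      a ∈ (homogeneousSubmodule (Fin 3) k e).map (Ideal.Quotient.mkₐ k I).toLinearMap) :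
    ∃ L ∈ homogeneousSubmodule (Fin 3) k 1,
      ∀ j : ℕ,
        (∀ a ∈ (homogeneousSubmodule (Fin 3) k j).map
            (Ideal.Quotient.mkₐ k I).toLinearMap,
          Ideal.Quotient.mk I L * a = 0 → a = 0) ∨
        (∀ b ∈ (homogeneousSubmodule (Fin 3) k (j + 1)).map
            (Ideal.Quotient.mkₐ k I).toLinearMap,
          ∃ a ∈ (homogeneousSubmodule (Fin 3) k j).map
              (Ideal.Quotient.mkₐ k I).toLinearMap,
            Ideal.Quotient.mk I L * a = b) := by
  
  obtain ⟨m1, m2, hdeg, hI⟩ := wlp_main k I hmono hart socle hsocle e htype2 hlevel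
  exact wlp_final k I m1 m2 hdeg hI
end

section
/- Let k be any field, let r ≥ 4 be an integer, R = k[x_1, …, x_r], and I = (x_1^4, x_2^3, …, x_{r−1}^3, x_r^4, x_1^2 x_r^2). Then A = R/I is an Artinian level algebra of type 2 with socle degree 2r, its Hilbert function h (h_j = dim_k A_j) satisfies h_0 ≤ h_1 ≤ ⋯ ≤ h_r ≥ h_{r+1} ≥ ⋯ ≥ h_{2r} = 2 as well as h_{r−j} ≤ h_{r+j} ≤ h_{r−j+1} for all 1 ≤ j ≤ r, but A fails the Weak Lefschetz Property: for every linear form L ∈ A_1 the multiplication map ×L : A_r → A_{r+1} is not surjective. -/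
open MvPolynomial

namespace WLPAux

/-- Centered trinomial coefficients. -/
def T (n : ℕ) (d : ℤ) : ℤ :=
  ∑ f : Fin n → Fin 3, if ∑ i, (((f i : ℕ) : ℤ) - 1) = d then 1 else 0

lemma T_zero (d : ℤ) : T 0 d = if d = 0 then 1 else 0 := by
  simp [T, eq_comm]

lemma T_succ (n : ℕ) (d : ℤ) : T (n + 1) d = T n (d + 1) + T n d + T n (d - 1) := by
  unfold T
  rw [← (Fin.consEquiv (fun _ : Fin (n + 1) => Fin 3)).sum_comp, Fintype.sum_prod_type,
    Fin.sum_univ_three]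
  simp only [Fin.consEquiv_apply, Fin.sum_univ_succ, Fin.cons_zero, Fin.cons_succ]
  refine congrArg₂ _ (congrArg₂ _ ?_ ?_) ?_ <;>
  · refine Finset.sum_congr rfl fun f _ => ?_
    congr 1
    simp only [Fin.val_zero, Fin.val_one, Fin.val_two, eq_iff_iff]
    push_cast
    constructor <;> intro h <;> linarith

lemma T_symm (n : ℕ) : ∀ d : ℤ, T n (-d) = T n d := by
  induction n with
  | zero => intro d; simp [T_zero]
  | succ n ih =>
    intro d
    rw [T_succ, T_succ, ← ih (d + 1), ← ih d, ← ih (d - 1)]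
    rw [show -(d + 1) = -d - 1 by ring, show -(d - 1) = -d + 1 by ring]
    ring

lemma T_anti (n : ℕ) : ∀ d : ℤ, 0 ≤ d → T n (d + 1) ≤ T n d := by
  induction n with
  | zero => intro d hd; rw [T_zero, T_zero]; split_ifs <;> omega
  | succ n ih =>
    intro d hd
    rw [T_succ, T_succ]
    have h1 := ih (d + 1) (by omega)
    rcases hd.eq_or_lt with h | h
    · subst h
      have := T_symm n 1
      norm_num at *
      linarith
    · have h2 := ih d hd
      have h3 := ih (d - 1) (by omega)
      rw [show d - 1 + 1 = d by ring] at h3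
      rw [show d + 1 - 1 = d by ring]
      linarith

lemma T_nat (n : ℕ) (a b : ℕ) (h : a ≤ b) : T n b ≤ T n a := by
  induction b, h using Nat.le_induction with
  | base => exact le_rfl
  | succ b _ ih => exact le_trans (by push_cast; exact T_anti n b (by omega)) ih

lemma T_abs (n : ℕ) (a : ℤ) : T n a = T n (a.natAbs : ℤ) := by
  rcases Int.natAbs_eq a with h | h
  · rw [← h]
  · conv_lhs => rw [h]
    exact T_symm n _

lemma T_le (n : ℕ) (a b : ℤ) (h : a.natAbs ≤ b.natAbs) : T n b ≤ T n a := by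
  rw [T_abs n a, T_abs n b]
  exact T_nat n _ _ h

lemma T_conc (n : ℕ) (hn : 1 ≤ n) : T n 0 + T n 3 ≤ T n 1 + T n 2 := by
  obtain ⟨n, rfl⟩ := Nat.exists_eq_add_of_le' hn
  simp only [T_succ]
  norm_num
  have := T_symm n 1
  have := T_le n 2 3 (by decide)
  have := T_le n 2 4 (by decide)
  have := T_le n 1 2 (by decide)
  have := T_le n 3 4 (by decide)
  linarith

lemma T_lt1 (n : ℕ) (hn : 1 ≤ n) : T n 2 < T n 1 := by
  induction n, hn using Nat.le_induction with
  | base => simp [T_succ, T_zero]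
  | succ n hn ih =>
    simp only [T_succ]
    norm_num
    have := T_le n 2 3 (by decide)
    have := T_le n 0 1 (by decide)
    linarith

lemma T_lt (n : ℕ) (hn : 2 ≤ n) : T n 1 < T n 0 := by
  obtain ⟨n, rfl⟩ := Nat.exists_eq_add_of_le' hn
  have := T_lt1 (n + 1) (by omega)
  have h1 := T_symm (n + 1) 1
  rw [T_succ (n + 1), T_succ (n + 1)]
  norm_num at *
  linarith

lemma T_top (n : ℕ) : (∀ d : ℤ, (n : ℤ) < d → T n d = 0) ∧ T n n = 1 := by
  induction n with
  | zero => 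
    refine ⟨fun d hd => ?_, by simp [T_zero]⟩
    rw [T_zero, if_neg (by push_cast at hd; omega)]
  | succ n ih =>
    obtain ⟨h0, h1⟩ := ih
    push_cast
    constructor
    · intro d hd
      rw [T_succ, h0 _ (by omega), h0 _ (by omega), h0 _ (by omega)]; rfl
    · rw [T_succ, h0 _ (by omega), h0 _ (by omega), show (n : ℤ) + 1 - 1 = n by ring, h1]; rfl

/-- The expected Hilbert function. -/
def H (n : ℕ) (s : ℤ) : ℤ :=
  T n (s + 2) + 2 * T n (s + 1) + 3 * T n s + 4 * T n (s - 1) + 2 * T n (s - 2)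

lemma H_up (n : ℕ) (s : ℤ) (hs : s < 0) : H n s ≤ H n (s + 1) := by
  unfold H
  rw [show s + 1 + 2 = s + 3 by ring, show s + 1 + 1 = s + 2 by ring,
    show s + 1 - 1 = s by ring, show s + 1 - 2 = s - 1 by ring]
  have := T_le n (s + 3) (s - 1) (by omega)
  have := T_le n (s + 2) (s - 1) (by omega)
  have := T_le n (s + 1) (s - 2) (by omega)
  have := T_le n s (s - 2) (by omega)
  linarith

lemma H_down (n : ℕ) (hn : 1 ≤ n) (s : ℤ) (hs : 0 ≤ s) : H n (s + 1) ≤ H n s := by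
  unfold H
  rw [show s + 1 + 2 = s + 3 by ring, show s + 1 + 1 = s + 2 by ring,
    show s + 1 - 1 = s by ring, show s + 1 - 2 = s - 1 by ring]
  rcases hs.eq_or_lt with h | h
  · subst h
    have := T_symm n 1
    have := T_symm n 2
    have := T_conc n hn
    norm_num at *
    linarith
  · have := T_le n (s - 1) (s) (by omega)
    have := T_le n (s - 1) (s + 1) (by omega)
    have := T_le n (s - 2) (s + 2) (by omega)
    have := T_le n (s - 2) (s + 3) (by omega)
    linarith

lemma H_a (n : ℕ) (s : ℤ) (hs : 1 ≤ s) : H n (-s) ≤ H n s := by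
  unfold H
  rw [← T_symm n (-s + 2), ← T_symm n (-s + 1), T_symm n s, ← T_symm n (-s - 1),
    ← T_symm n (-s - 2), show -(-s + 2) = s - 2 by ring, show -(-s + 1) = s - 1 by ring,
    show -(-s - 1) = s + 1 by ring, show -(-s - 2) = s + 2 by ring]
  have := T_le n (s - 2) (s + 2) (by omega)
  have := T_le n (s - 1) (s + 1) (by omega)
  linarith

lemma H_b (n : ℕ) (hn : 1 ≤ n) (s : ℤ) (hs : 1 ≤ s) : H n s ≤ H n (-s + 1) := by
  unfold H
  rw [← T_symm n (-s + 1 + 2), ← T_symm n (-s + 1 + 1), ← T_symm n (-s + 1),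
    show -s + 1 - 1 = - s by ring, T_symm n s,
    ← T_symm n (-s + 1 - 2), show -(-s + 1 + 2) = s - 3 by ring,
    show -(-s + 1 + 1) = s - 2 by ring,
    show -(-s + 1) = s - 1 by ring, show -(-s + 1 - 2) = s + 1 by ring]
  rcases hs.eq_or_lt with h | h
  · subst h
    have := T_symm n 1
    have := T_symm n 2
    have := T_conc n hn
    norm_num at *
    linarith
  · have := T_le n (s - 3) (s - 1) (by omega)
    have := T_le n s (s + 2) (by omega)
    linarith

lemma H_top (n : ℕ) : H n (n + 2) = 2 := by
  obtain ⟨h0, h1⟩ := T_top n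
  unfold H
  rw [h0 _ (by omega), h0 _ (by omega), h0 _ (by omega), h0 _ (by omega),
    show (n : ℤ) + 2 - 2 = n by ring, h1]
  rfl


/-- Standard exponents. -/
def Std {n : ℕ} (m : Fin (n + 2) →₀ ℕ) : Prop :=
  m 0 ≤ 3 ∧ m (Fin.last (n + 1)) ≤ 3 ∧ ¬ (2 ≤ m 0 ∧ 2 ≤ m (Fin.last (n + 1))) ∧
    ∀ i : Fin n, m i.castSucc.succ ≤ 2

lemma degree_split {n : ℕ} (m : Fin (n + 2) →₀ ℕ) :
    m.degree = m 0 + m (Fin.last (n + 1)) + ∑ i : Fin n, m i.castSucc.succ := by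
  rw [Finsupp.degree_eq_sum, Fin.sum_univ_succ, Fin.sum_univ_castSucc, Fin.succ_last]
  ring

/-- Exponent from its parts. -/
noncomputable def mkE {n : ℕ} (p q : ℕ) (f : Fin n → ℕ) : Fin (n + 2) →₀ ℕ :=
  Finsupp.equivFunOnFinite.symm (Fin.cons p (Fin.snoc f q : Fin (n + 1) → ℕ) : Fin (n + 2) → ℕ)

@[simp] lemma mkE_zero {n : ℕ} (p q : ℕ) (f : Fin n → ℕ) : mkE p q f 0 = p := by
  simp [mkE]

@[simp] lemma mkE_last {n : ℕ} (p q : ℕ) (f : Fin n → ℕ) :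
    mkE p q f (Fin.last (n + 1)) = q := by
  rw [← Fin.succ_last]; simp [mkE, -Fin.succ_last]

@[simp] lemma mkE_mid {n : ℕ} (p q : ℕ) (f : Fin n → ℕ) (i : Fin n) :
    mkE p q f i.castSucc.succ = f i := by
  simp [mkE]

lemma fin_cases' {n : ℕ} (i : Fin (n + 2)) :
    i = 0 ∨ i = Fin.last (n + 1) ∨ ∃ j : Fin n, i = j.castSucc.succ := by
  refine Fin.cases (Or.inl rfl) (fun i => ?_) i
  refine Fin.lastCases ?_ (fun i => ?_) i
  · right; left; exact Fin.succ_last _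
  · right; right; exact ⟨i, rfl⟩

lemma ext_parts {n : ℕ} {m m' : Fin (n + 2) →₀ ℕ} (h0 : m 0 = m' 0)
    (h1 : m (Fin.last (n + 1)) = m' (Fin.last (n + 1)))
    (h2 : ∀ i : Fin n, m i.castSucc.succ = m' i.castSucc.succ) : m = m' := by
  ext i
  rcases fin_cases' i with rfl | rfl | ⟨j, rfl⟩
  · exact h0
  · exact h1
  · exact h2 j

lemma sum_shift {n : ℕ} (f : Fin n → ℕ) (d : ℤ) :
    ∑ i, ((f i : ℤ) - 1) = d ↔ ((∑ i, f i : ℕ) : ℤ) = d + n := by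
  rw [Finset.sum_sub_distrib]; push_cast; simp; constructor <;> intro h <;> linarith

/-- Equivalence describing standard exponents of degree j. -/
noncomputable def stdEquiv (n j : ℕ) : {m : Fin (n + 2) →₀ ℕ // Std m ∧ m.degree = j} ≃
    {x : Fin 4 × Fin 4 × (Fin n → Fin 3) // ¬ (2 ≤ (x.1 : ℕ) ∧ 2 ≤ (x.2.1 : ℕ)) ∧
      (x.1 : ℕ) + (x.2.1 : ℕ) + ∑ i, (x.2.2 i : ℕ) = j} where
  toFun m := ⟨(⟨m.1 0, by have := m.2.1.1; omega⟩,
      ⟨m.1 (Fin.last (n + 1)), by have := m.2.1.2.1; omega⟩,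
      fun i => ⟨m.1 i.castSucc.succ, by have := m.2.1.2.2.2 i; omega⟩),
      m.2.1.2.2.1, (degree_split m.1).symm.trans m.2.2⟩
  invFun x := ⟨mkE x.1.1 x.1.2.1 (fun i => x.1.2.2 i), by
    refine ⟨⟨?_, ?_, ?_, fun i => ?_⟩, ?_⟩
    · simp; omega
    · simp; omega
    · simpa using x.2.1
    · simp; omega
    · rw [degree_split]; simpa using x.2.2⟩
  left_inv m := by
    apply Subtype.ext
    apply ext_parts <;> simp
  right_inv x := by
    apply Subtype.ext
    simp

lemma card_std (n j : ℕ) :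
    (Nat.card {m : Fin (n + 2) →₀ ℕ // Std m ∧ m.degree = j} : ℤ) = H n ((j : ℤ) - (n + 2)) := by
  rw [Nat.card_congr (stdEquiv n j), Nat.card_eq_fintype_card, Fintype.card_subtype,
    Finset.card_filter]
  push_cast
  rw [Fintype.sum_prod_type]
  simp_rw [Fintype.sum_prod_type]
  have key : ∀ p q : Fin 4, (∑ f : Fin n → Fin 3,
      if ¬ (2 ≤ (p : ℕ) ∧ 2 ≤ (q : ℕ)) ∧ (p : ℕ) + (q : ℕ) + ∑ i, (f i : ℕ) = j
        then (1 : ℤ) else 0) =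
      if (2 ≤ (p : ℕ) ∧ 2 ≤ (q : ℕ)) then 0 else T n ((j : ℤ) - n - (p : ℕ) - (q : ℕ)) := by
    intro p q
    split_ifs with h
    · simp [h]
    · unfold T
      refine Finset.sum_congr rfl fun f _ => ?_
      congr 1
      rw [sum_shift (fun i => (f i : ℕ))]
      simp only [h, not_false_eq_true, true_and, eq_iff_iff]
      omega
  simp only [key, Fin.sum_univ_four]
  norm_num [H]
  ring_nf

instance std_finite (n : ℕ) : Finite {m : Fin (n + 2) →₀ ℕ // Std m} := by
  refine Finite.of_injective (β := Fin 4 × Fin 4 × (Fin n → Fin 3))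
    (fun m => (⟨m.1 0, by have := m.2.1; omega⟩,
      ⟨m.1 (Fin.last (n + 1)), by have := m.2.2.1; omega⟩,
      fun i => ⟨m.1 i.castSucc.succ, by have := m.2.2.2.2 i; omega⟩)) ?_
  intro a b hab
  simp only [Prod.mk.injEq, Fin.mk.injEq, funext_iff] at hab
  exact Subtype.ext (ext_parts hab.1 hab.2.1 hab.2.2)

instance std_finite' (n j : ℕ) : Finite {m : Fin (n + 2) →₀ ℕ // Std m ∧ m.degree = j} :=
  Finite.of_equiv _ (stdEquiv n j).symm

lemma std_degree_le {n : ℕ} {m : Fin (n + 2) →₀ ℕ} (h : Std m) : m.degree ≤ 2 * (n + 2) := by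
  rw [degree_split]
  obtain ⟨h0, h1, h2, h3⟩ := h
  have := Finset.sum_le_card_nsmul Finset.univ (fun i : Fin n => m i.castSucc.succ) 2
    (fun i _ => h3 i)
  simp at this
  omega

lemma std_max {n : ℕ} {m : Fin (n + 2) →₀ ℕ} (h : Std m)
    (hm : ∀ i, ¬ Std (m + Finsupp.single i 1)) : m.degree = 2 * (n + 2) := by
  rw [degree_split]
  have hl0 : (Fin.last (n + 1)) ≠ 0 := by simp [Fin.ext_iff]
  have hmid : ∀ i : Fin n, m i.castSucc.succ = 2 := by
    intro i
    by_contra hne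
    apply hm i.castSucc.succ
    have h00 : i.castSucc.succ ≠ 0 := Fin.succ_ne_zero _
    have h01 : i.castSucc.succ ≠ Fin.last (n + 1) := by
      simp [Fin.ext_iff]; omega
    obtain ⟨h0, h1, h2, h3⟩ := h
    refine ⟨?_, ?_, ?_, fun j => ?_⟩
    · simpa [Finsupp.single_apply, h00] using h0
    · simpa [Finsupp.single_apply, h01] using h1
    · simpa [Finsupp.single_apply, h00, h01] using h2
    · have := h3 j
      have := h3 i
      rw [Finsupp.add_apply, Finsupp.single_apply]
      split_ifs with hij
      · rw [← hij]; omega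
      · omega
  obtain ⟨h0, h1, h2, h3⟩ := h
  have hA := hm 0
  have hB := hm (Fin.last (n + 1))
  have e1 : ∀ j : Fin n, Fin.last (n + 1) ≠ j.castSucc.succ := by
    intro j; simp [Fin.ext_iff]; omega
  have e2 : ∀ j : Fin n, 0 ≠ j.castSucc.succ := fun j => (Fin.succ_ne_zero _).symm
  simp only [Std, Finsupp.add_apply, Finsupp.single_apply, hl0, hl0.symm, e1, e2, if_true,
    if_false, add_zero, h3, implies_true, and_true] at hA hB
  simp only [hmid]
  simp
  omega

lemma mem_I {k : Type*} [Field k] {n : ℕ} (I : Ideal (MvPolynomial (Fin (n + 2)) k))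
    (hI : I = Ideal.span
      ({X (0 : Fin (n + 2)) ^ 4, X (Fin.last (n + 1)) ^ 4,
        X (0 : Fin (n + 2)) ^ 2 * X (Fin.last (n + 1)) ^ 2} ∪
       {f | ∃ i : Fin (n + 2), (i : ℕ) ≠ 0 ∧ (i : ℕ) ≠ n + 1 ∧ f = X i ^ 3}))
    (p : MvPolynomial (Fin (n + 2)) k) :
    p ∈ I ↔ ∀ m, Std m → coeff m p = 0 := by
  have hset : ({X (0 : Fin (n + 2)) ^ 4, X (Fin.last (n + 1)) ^ 4,
        X (0 : Fin (n + 2)) ^ 2 * X (Fin.last (n + 1)) ^ 2} ∪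
       {f | ∃ i : Fin (n + 2), (i : ℕ) ≠ 0 ∧ (i : ℕ) ≠ n + 1 ∧ f = X i ^ 3} :
       Set (MvPolynomial (Fin (n + 2)) k)) =
      (fun s => monomial s (1 : k)) '' ({Finsupp.single 0 4, Finsupp.single (Fin.last (n + 1)) 4,
        Finsupp.single 0 2 + Finsupp.single (Fin.last (n + 1)) 2} ∪
        {s | ∃ i : Fin (n + 2), (i : ℕ) ≠ 0 ∧ (i : ℕ) ≠ n + 1 ∧ s = Finsupp.single i 3}) := by
    rw [Set.image_union, Set.image_insert_eq, Set.image_insert_eq, Set.image_singleton]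
    congr 1
    · simp [X_pow_eq_monomial, monomial_mul]
    · ext f
      constructor
      · rintro ⟨i, h0, h1, rfl⟩
        exact ⟨_, ⟨i, h0, h1, rfl⟩, by simp [X_pow_eq_monomial]⟩
      · rintro ⟨_, ⟨i, h0, h1, rfl⟩, rfl⟩
        exact ⟨i, h0, h1, by simp [X_pow_eq_monomial]⟩
  have hl0 : (Fin.last (n + 1)) ≠ 0 := by simp [Fin.ext_iff]
  rw [hI, hset, mem_ideal_span_monomial_image]
  have key : ∀ m : Fin (n + 2) →₀ ℕ,
      (∃ si ∈ ({Finsupp.single 0 4, Finsupp.single (Fin.last (n + 1)) 4,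
        Finsupp.single 0 2 + Finsupp.single (Fin.last (n + 1)) 2} ∪
        {s | ∃ i : Fin (n + 2), (i : ℕ) ≠ 0 ∧ (i : ℕ) ≠ n + 1 ∧ s = Finsupp.single i 3} :
        Set (Fin (n + 2) →₀ ℕ)), si ≤ m) ↔ ¬ Std m := by
    intro m
    constructor
    · rintro ⟨s, hs, hsm⟩ ⟨h0, h1, h2, h3⟩
      rcases hs with (rfl | rfl | rfl) | ⟨i, hi0, hi1, rfl⟩
      · have := hsm 0
        simp at this; omega
      · have := hsm (Fin.last (n + 1))
        simp at this; omega
      · have a1 := hsm 0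
        have a2 := hsm (Fin.last (n + 1))
        simp [hl0, hl0.symm] at a1 a2
        omega
      · have := hsm i
        simp at this
        rcases fin_cases' i with rfl | rfl | ⟨j, rfl⟩
        · simp at hi0
        · simp at hi1
        · have := h3 j; omega
    · intro h
      by_contra hcon
      push Not at hcon
      apply h
      refine ⟨?_, ?_, ?_, fun i => ?_⟩
      · by_contra hh
        exact hcon _ (Or.inl (Or.inl rfl)) (by rw [Finsupp.single_le_iff]; omega)
      · by_contra hh
        exact hcon _ (Or.inl (Or.inr (Or.inl rfl))) (by rw [Finsupp.single_le_iff]; omega)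
      · rintro ⟨a1, a2⟩
        refine hcon _ (Or.inl (Or.inr (Or.inr rfl))) ?_
        intro i
        rw [Finsupp.add_apply, Finsupp.single_apply, Finsupp.single_apply]
        split_ifs with b1 b2 b2
        · exact absurd (b2.trans b1.symm) hl0
        · subst b1; simpa using a1
        · subst b2; simpa using a2
        · simp
      · by_contra hh
        refine hcon _ (Or.inr ⟨i.castSucc.succ, by simp, by simp; omega, rfl⟩)
          (by rw [Finsupp.single_le_iff]; omega)
  simp only [key, mem_support_iff]
  exact forall_congr' fun m => by tauto

lemma finrank_range_eq {k V W U : Type*} [Field k] [AddCommGroup V] [Module k V]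
    [AddCommGroup W] [Module k W] [AddCommGroup U] [Module k U]
    (f : V →ₗ[k] W) (g : V →ₗ[k] U) (h : LinearMap.ker f = LinearMap.ker g) :
    Nonempty (LinearMap.range f ≃ₗ[k] LinearMap.range g) :=
  ⟨f.quotKerEquivRange.symm.trans ((Submodule.quotEquivOfEq _ _ h).trans g.quotKerEquivRange)⟩

/-- Coefficient map. -/
noncomputable def coeffMap (k : Type*) [Field k] {σ : Type*} (P : (σ →₀ ℕ) → Prop) :
    MvPolynomial σ k →ₗ[k] ({m // P m} → k) :=
  LinearMap.pi fun m => lcoeff k m.1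

lemma coeffMap_apply (k : Type*) [Field k] {σ : Type*} (P : (σ →₀ ℕ) → Prop)
    (p : MvPolynomial σ k) (m) : coeffMap k P p m = coeff m.1 p := rfl

lemma finite_quot {k : Type*} [Field k] {n : ℕ}
    (I : Ideal (MvPolynomial (Fin (n + 2)) k))
    (hI : ∀ p, p ∈ I ↔ ∀ m, Std m → coeff m p = 0) : FiniteDimensional k (MvPolynomial (Fin (n + 2)) k ⧸ I) := by
  have hker : LinearMap.ker (Ideal.Quotient.mkₐ k I).toLinearMap =
      LinearMap.ker (coeffMap k (Std (n := n))) := by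
    ext p
    rw [LinearMap.mem_ker, LinearMap.mem_ker, funext_iff]
    simp only [coeffMap_apply, AlgHom.toLinearMap_apply, Ideal.Quotient.mkₐ_eq_mk,
      Ideal.Quotient.eq_zero_iff_mem, hI, Subtype.forall, Pi.zero_apply]
  obtain ⟨e⟩ := finrank_range_eq _ _ hker
  have hr : LinearMap.range (Ideal.Quotient.mkₐ k I).toLinearMap = ⊤ :=
    LinearMap.range_eq_top.2 (Ideal.Quotient.mkₐ_surjective k I)
  have : FiniteDimensional k (LinearMap.range (Ideal.Quotient.mkₐ k I).toLinearMap) :=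
    e.symm.finiteDimensional
  rw [hr] at this
  exact (Submodule.topEquiv (R := k) (M := MvPolynomial (Fin (n + 2)) k ⧸ I)).finiteDimensional

lemma finrank_A {k : Type*} [Field k] {n : ℕ}
    (I : Ideal (MvPolynomial (Fin (n + 2)) k))
    (hI : ∀ p, p ∈ I ↔ ∀ m, Std m → coeff m p = 0) (j : ℕ) :
    Module.finrank k ((homogeneousSubmodule (Fin (n + 2)) k j).map
      (Ideal.Quotient.mkₐ k I).toLinearMap) =
      Nat.card {m : Fin (n + 2) →₀ ℕ // Std m ∧ m.degree = j} := by
  rw [← LinearMap.range_domRestrict]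
  have hker : LinearMap.ker ((Ideal.Quotient.mkₐ k I).toLinearMap.domRestrict
      (homogeneousSubmodule (Fin (n + 2)) k j)) =
      LinearMap.ker ((coeffMap k (fun m : Fin (n + 2) →₀ ℕ => Std m ∧ m.degree = j)).domRestrict
      (homogeneousSubmodule (Fin (n + 2)) k j)) := by
    ext ⟨p, hp⟩
    rw [LinearMap.mem_ker, LinearMap.mem_ker, funext_iff]
    simp only [LinearMap.domRestrict_apply, coeffMap_apply, AlgHom.toLinearMap_apply,
      Ideal.Quotient.mkₐ_eq_mk,
      Ideal.Quotient.eq_zero_iff_mem, hI, Subtype.forall, Pi.zero_apply]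
    constructor
    · intro h m hm; exact h m hm.1
    · intro h m hm
      by_cases hd : m.degree = j
      · exact h m ⟨hm, hd⟩
      · exact IsHomogeneous.coeff_eq_zero hp hd
  obtain ⟨e⟩ := finrank_range_eq _ _ hker
  rw [e.finrank_eq]
  have hr : LinearMap.range ((coeffMap k (fun m : Fin (n + 2) →₀ ℕ => Std m ∧ m.degree = j)).domRestrict
      (homogeneousSubmodule (Fin (n + 2)) k j)) = ⊤ := by
    rw [LinearMap.range_eq_top]
    classical
    have := Fintype.ofFinite {m : Fin (n + 2) →₀ ℕ // Std m ∧ m.degree = j}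
    intro g
    refine ⟨⟨∑ m, monomial m.1 (g m), ?_⟩, ?_⟩
    · exact Submodule.sum_mem _ fun m _ => isHomogeneous_monomial _ m.2.2
    · ext m
      simp only [LinearMap.domRestrict_apply, coeffMap_apply, coeff_sum, coeff_monomial]
      simp [← Subtype.ext_iff]
  have := Fintype.ofFinite {m : Fin (n + 2) →₀ ℕ // Std m ∧ m.degree = j}
  rw [hr, finrank_top, Module.finrank_fintype_fun_eq_card, Nat.card_eq_fintype_card]

lemma mem_A {k : Type*} [Field k] {n : ℕ}
    (I : Ideal (MvPolynomial (Fin (n + 2)) k))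
    (hI : ∀ p, p ∈ I ↔ ∀ m, Std m → coeff m p = 0) (j : ℕ) (p : MvPolynomial (Fin (n + 2)) k) :
    Ideal.Quotient.mk I p ∈ (homogeneousSubmodule (Fin (n + 2)) k j).map
      (Ideal.Quotient.mkₐ k I).toLinearMap ↔
      ∀ m, Std m → coeff m p ≠ 0 → m.degree = j := by
  constructor
  · rintro ⟨q, hq, hqp⟩ m hm hc
    have h1 : q - p ∈ I := (Ideal.Quotient.eq).1 hqp
    have h2 := (hI _).1 h1 m hm
    rw [coeff_sub, sub_eq_zero] at h2
    by_contra hd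
    exact hc (h2 ▸ IsHomogeneous.coeff_eq_zero hq hd)
  · intro h
    refine ⟨homogeneousComponent j p, homogeneousComponent_mem _ _, ?_⟩
    refine (Ideal.Quotient.eq).2 ((hI _).2 fun m hm => ?_)
    rw [coeff_sub, coeff_homogeneousComponent]
    split_ifs with hd
    · simp
    · by_contra hc
      exact hd (h m hm (by simpa using hc))

lemma socle_iff {k : Type*} [Field k] {n : ℕ}
    (I : Ideal (MvPolynomial (Fin (n + 2)) k))
    (hI : ∀ p, p ∈ I ↔ ∀ m, Std m → coeff m p = 0) (a : MvPolynomial (Fin (n + 2)) k ⧸ I) :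
    a ∈ (homogeneousSubmodule (Fin (n + 2)) k (2 * (n + 2))).map
      (Ideal.Quotient.mkₐ k I).toLinearMap ↔
      ∀ i, Ideal.Quotient.mk I (X i) * a = 0 := by
  obtain ⟨p, rfl⟩ := Ideal.Quotient.mk_surjective a
  rw [mem_A I hI]
  simp only [← map_mul, Ideal.Quotient.eq_zero_iff_mem, hI]
  constructor
  · intro h i m hm
    rw [coeff_X_mul']
    split_ifs with hs
    · by_contra hc
      have hle : Finsupp.single i 1 ≤ m := by
        rw [Finsupp.single_le_iff]
        have := Finsupp.mem_support_iff.1 hs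
        omega
      have hadd : m - Finsupp.single i 1 + Finsupp.single i 1 = m := tsub_add_cancel_of_le hle
      have hst : Std (m - Finsupp.single i 1) := by
        have hl : ∀ x, (m - Finsupp.single i 1 : Fin (n + 2) →₀ ℕ) x ≤ m x :=
          fun x => by simp
        obtain ⟨h0, h1, h2, h3⟩ := hm
        have := hl 0
        have := hl (Fin.last (n + 1))
        exact ⟨by omega, by omega, by omega, fun j => (hl _).trans (h3 j)⟩
      have h1 := h _ hst hc
      have h2 := std_degree_le hm
      rw [← hadd, map_add, Finsupp.degree_single] at h2
      omega
    · rfl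
  · intro h m hm hc
    refine std_max hm fun i hs => hc ?_
    have := h i _ hs
    rwa [add_comm m, coeff_X_mul] at this

/-- Equivalence of exponent vectors with functions to `Fin 3`. -/
def midEquiv (n : ℕ) (d : ℤ) :
    {f : Fin n → ℕ // (∀ i, f i ≤ 2) ∧ ∑ i, ((f i : ℤ) - 1) = d} ≃
    {f : Fin n → Fin 3 // ∑ i, (((f i : ℕ) : ℤ) - 1) = d} where
  toFun f := ⟨fun i => ⟨f.1 i, by have := f.2.1 i; omega⟩, f.2.2⟩
  invFun f := ⟨fun i => f.1 i, fun i => Nat.le_of_lt_succ (f.1 i).2, f.2⟩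
  left_inv f := rfl
  right_inv f := rfl

lemma card_mid (n : ℕ) (d : ℤ) :
    (Nat.card {f : Fin n → ℕ // (∀ i, f i ≤ 2) ∧ ∑ i, ((f i : ℤ) - 1) = d} : ℤ) = T n d := by
  rw [Nat.card_congr (midEquiv n d), Nat.card_eq_fintype_card, Fintype.card_subtype,
    Finset.card_filter]
  push_cast
  rfl

lemma exists_H {k : Type*} [Field k] (n : ℕ) (hn : 2 ≤ n) (c : Fin n → k) :
    ∃ g : (Fin n → ℕ) → k, (∃ v, g v ≠ 0) ∧
      (∀ v : Fin n → ℕ, g v ≠ 0 → (∀ i, v i ≤ 2) ∧ ∑ i, v i = n) ∧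
      ∀ v : Fin n → ℕ, ∑ i, c i * g (v + Pi.single i 1) = 0 := by
  classical
  let S : ℤ → Type := fun d => {f : Fin n → ℕ // (∀ i, f i ≤ 2) ∧ ∑ i, ((f i : ℤ) - 1) = d}
  have hfin : ∀ d, Finite (S d) := fun d => Finite.of_equiv _ (midEquiv n d).symm
  have : ∀ d, Fintype (S d) := fun d => Fintype.ofFinite _
  let ext : (S 0 → k) →ₗ[k] ((Fin n → ℕ) → k) :=
    Function.ExtendByZero.linearMap k (Subtype.val : S 0 → (Fin n → ℕ))
  have hext : ∀ g (s : S 0), ext g s.1 = g s := fun g s =>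
    Subtype.val_injective.extend_apply g 0 s
  have hext0 : ∀ g (v : Fin n → ℕ), ext g v ≠ 0 → (∀ i, v i ≤ 2) ∧ ∑ i, ((v i : ℤ) - 1) = 0 := by
    intro g v hv
    by_contra hcon
    apply hv
    refine Function.extend_apply' (f := (Subtype.val : S 0 → (Fin n → ℕ))) g
      (0 : (Fin n → ℕ) → k) v ?_
    rintro ⟨s, rfl⟩
    exact hcon s.2
  let Λ : (S 0 → k) →ₗ[k] (S (-1) → k) :=
    LinearMap.pi fun s => ∑ i, c i • (LinearMap.proj (s.1 + Pi.single i 1)).comp ext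
  have hΛ : ∀ g s, Λ g s = ∑ i, c i * ext g (s.1 + Pi.single i 1) := by
    intro g s
    simp [Λ, LinearMap.sum_apply]
  have hlt : Module.finrank k (S (-1) → k) < Module.finrank k (S 0 → k) := by
    rw [Module.finrank_fintype_fun_eq_card, Module.finrank_fintype_fun_eq_card,
      ← Nat.card_eq_fintype_card, ← Nat.card_eq_fintype_card]
    have h1 := card_mid n (-1)
    have h2 := card_mid n 0
    have h3 := T_lt n hn
    rw [T_symm] at h1
    zify
    rw [h1, h2]
    exact h3
  have hne := Λ.ker_ne_bot_of_finrank_lt hlt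
  obtain ⟨g, hg, hg0⟩ := (Submodule.ne_bot_iff _).1 hne
  obtain ⟨s, hs⟩ := Function.ne_iff.1 hg0
  refine ⟨ext g, ⟨s.1, by rw [hext]; exact hs⟩, fun v hv => ?_, fun v => ?_⟩
  · obtain ⟨h1, h2⟩ := hext0 g v hv
    refine ⟨h1, ?_⟩
    rw [sum_shift] at h2
    omega
  · by_cases hv : (∀ i, v i ≤ 2) ∧ ∑ i, ((v i : ℤ) - 1) = -1
    · rw [← hΛ g ⟨v, hv⟩, LinearMap.mem_ker.1 hg]; rfl
    · refine Finset.sum_eq_zero fun i _ => ?_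
      by_contra hc
      obtain ⟨h1, h2⟩ := hext0 g _ (right_ne_zero_of_mul hc)
      apply hv
      constructor
      · intro j
        have := h1 j
        simp only [Pi.add_apply] at this
        omega
      · rw [sum_shift] at h2 ⊢
        simp only [Pi.add_apply, Finset.sum_add_distrib, Finset.sum_pi_single', Finset.mem_univ,
          if_true] at h2
        push_cast at h2 ⊢
        linarith

lemma exists_G {k : Type*} [Field k] (a b : k) :
    ∃ G : ℕ → ℕ → k, (∃ p q, G p q ≠ 0) ∧ (∀ p q, G p q ≠ 0 → p + q = 3) ∧
      ∀ p q, a * G (p + 1) q + b * G p (q + 1) = 0 := by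
  by_cases h : a = 0 ∧ b = 0
  · obtain ⟨rfl, rfl⟩ := h
    refine ⟨fun p q => if p + q = 3 then 1 else 0, ⟨3, 0, by simp⟩, fun p q hpq => ?_, ?_⟩
    · by_contra hc; simp [hc] at hpq
    · simp
  · refine ⟨fun p q => if p + q = 3 then b ^ p * (-a) ^ q else 0, ?_, fun p q hpq => ?_,
      fun p q => ?_⟩
    · by_cases ha : a = 0
      · have hb : b ≠ 0 := fun hb => h ⟨ha, hb⟩
        exact ⟨3, 0, by simp [hb]⟩
      · exact ⟨0, 3, by simp [ha]⟩
    · by_contra hc; simp [hc] at hpq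
    · have e : p + 1 + q = p + (q + 1) := by ring
      simp only [e]
      split_ifs
      · ring
      · ring

lemma exists_F {k : Type*} [Field k] (n : ℕ) (hn : 2 ≤ n) (l : Fin (n + 2) → k) :
    ∃ F : (Fin (n + 2) →₀ ℕ) → k, (∃ m, F m ≠ 0) ∧
      (∀ m, F m ≠ 0 → Std m ∧ m.degree = n + 3) ∧
      ∀ m, ∑ i, l i * F (m + Finsupp.single i 1) = 0 := by
  classical
  obtain ⟨g, ⟨v, hv⟩, hg1, hg2⟩ := exists_H n hn (fun i => l i.castSucc.succ)
  obtain ⟨G, ⟨p, q, hpq⟩, hG1, hG2⟩ := exists_G (l 0) (l (Fin.last (n + 1)))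
  have hl0 : (Fin.last (n + 1)) ≠ 0 := by simp [Fin.ext_iff]
  have e1 : ∀ j : Fin n, Fin.last (n + 1) ≠ j.castSucc.succ := by
    intro j; simp [Fin.ext_iff]; omega
  have e2 : ∀ j : Fin n, 0 ≠ j.castSucc.succ := fun j => (Fin.succ_ne_zero _).symm
  refine ⟨fun m => G (m 0) (m (Fin.last (n + 1))) * g (fun i => m i.castSucc.succ),
    ⟨mkE p q v, by simpa using ⟨hpq, hv⟩⟩, fun m hm => ?_, fun m => ?_⟩
  · have h1 := hG1 _ _ (left_ne_zero_of_mul hm)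
    obtain ⟨h2, h3⟩ := hg1 _ (right_ne_zero_of_mul hm)
    refine ⟨⟨by omega, by omega, by omega, h2⟩, ?_⟩
    rw [degree_split, h1, h3]; omega
  · rw [Fin.sum_univ_succ, Fin.sum_univ_castSucc, Fin.succ_last]
    have hmid : ∀ j : Fin n, (fun i : Fin n =>
        (m + Finsupp.single j.castSucc.succ 1 : Fin (n + 2) →₀ ℕ) i.castSucc.succ)
        = (fun i : Fin n => m i.castSucc.succ) + Pi.single j 1 := by
      intro j
      ext i
      simp [Finsupp.single_apply, Pi.single_apply, eq_comm (a := i)]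
    simp only [hmid]
    simp only [Finsupp.add_apply, Finsupp.single_apply, hl0, hl0.symm, e1, e2, (e1 _).symm,
      (e2 _).symm, if_true, if_false, add_zero]
    have h1 := hG2 (m 0) (m (Fin.last (n + 1)))
    have h2 := hg2 (fun i => m i.castSucc.succ)
    have h3 : ∑ x : Fin n, l x.castSucc.succ * (G (m 0) (m (Fin.last (n + 1))) *
        g ((fun i : Fin n => m i.castSucc.succ) + Pi.single x 1)) = 0 := by
      rw [← mul_zero (G (m 0) (m (Fin.last (n + 1)))), ← h2, Finset.mul_sum]
      exact Finset.sum_congr rfl fun x _ => by ring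
    rw [h3]
    linear_combination g (fun i => m i.castSucc.succ) * h1

lemma not_surj {k : Type*} [Field k] {n : ℕ} (hn : 2 ≤ n)
    (I : Ideal (MvPolynomial (Fin (n + 2)) k))
    (hI : ∀ p, p ∈ I ↔ ∀ m, Std m → coeff m p = 0)
    (L : MvPolynomial (Fin (n + 2)) k) (hL : L ∈ homogeneousSubmodule (Fin (n + 2)) k 1) :
    ∃ b ∈ (homogeneousSubmodule (Fin (n + 2)) k (n + 2 + 1)).map
      (Ideal.Quotient.mkₐ k I).toLinearMap, ∀ a, Ideal.Quotient.mk I L * a ≠ b := by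
  classical
  rw [homogeneousSubmodule_one_eq_span_X, Submodule.mem_span_range_iff_exists_fun] at hL
  obtain ⟨l, rfl⟩ := hL
  obtain ⟨F, ⟨m0, hm0⟩, hF1, hF2⟩ := exists_F n hn l
  let φ : MvPolynomial (Fin (n + 2)) k →ₗ[k] k := (basisMonomials (Fin (n + 2)) k).constr k F
  have hφ : ∀ m, φ (monomial m 1) = F m := fun m => by
    have := (basisMonomials (Fin (n + 2)) k).constr_basis k F m
    rwa [coe_basisMonomials] at this
  have hφ' : ∀ m c, φ (monomial m c) = c * F m := fun m c => by
    rw [← hφ, ← smul_eq_mul, ← map_smul, smul_monomial, smul_eq_mul, mul_one]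
  have hφI : ∀ p ∈ I, φ p = 0 := by
    intro p hp
    rw [p.as_sum, map_sum]
    refine Finset.sum_eq_zero fun m _ => ?_
    rw [hφ']
    by_contra hc
    exact left_ne_zero_of_mul hc ((hI p).1 hp m (hF1 m (right_ne_zero_of_mul hc)).1)
  have hφL : ∀ q, φ ((∑ i, l i • X i) * q) = 0 := by
    intro q
    rw [q.as_sum, Finset.mul_sum, map_sum]
    refine Finset.sum_eq_zero fun m _ => ?_
    rw [Finset.sum_mul, map_sum]
    have : ∀ i, φ (l i • X i * monomial m (coeff m q)) =
        coeff m q * (l i * F (m + Finsupp.single i 1)) := by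
      intro i
      rw [smul_mul_assoc, map_smul, X, monomial_mul, hφ', smul_eq_mul, add_comm m]
      ring
    simp only [this]
    rw [← Finset.mul_sum, hF2, mul_zero]
  refine ⟨Ideal.Quotient.mk I (monomial m0 1), ?_, ?_⟩
  · exact ⟨_, isHomogeneous_monomial _ (hF1 m0 hm0).2, rfl⟩
  · intro a ha
    obtain ⟨q, rfl⟩ := Ideal.Quotient.mk_surjective a
    rw [← map_mul, Ideal.Quotient.eq] at ha
    have := hφI _ ha
    rw [map_sub, hφL, hφ, zero_sub, neg_eq_zero] at this
    exact hm0 this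

end WLPAux

/-- For any field `k` and `r ≥ 4`, the quotient of
`R = k[x₁, …, x_r]` by `I = (x₁⁴, x₂³, …, x_{r−1}³, x_r⁴, x₁²x_r²)` is an Artinian level
algebra of type 2 with socle degree `2r`, its Hilbert function satisfies
`h₀ ≤ ⋯ ≤ h_r ≥ ⋯ ≥ h_{2r} = 2` and `h_{r−j} ≤ h_{r+j} ≤ h_{r−j+1}` for `1 ≤ j ≤ r`,
yet it fails the WLP: for every linear form `L` multiplication by `L` from degree `r`
to degree `r+1` is not surjective. -/
theorem monomial_level_type_two_fails_WLP
    (k : Type*) [Field k] (r : ℕ) (hr : 4 ≤ r)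
    (I : Ideal (MvPolynomial (Fin r) k))
    (hI : I = Ideal.span
      ({X (⟨0, by omega⟩ : Fin r) ^ 4, X (⟨r - 1, by omega⟩ : Fin r) ^ 4,
        X (⟨0, by omega⟩ : Fin r) ^ 2 * X (⟨r - 1, by omega⟩ : Fin r) ^ 2} ∪
       {f | ∃ i : Fin r, (i : ℕ) ≠ 0 ∧ (i : ℕ) ≠ r - 1 ∧ f = X i ^ 3}))
    (A : ℕ → Submodule k (MvPolynomial (Fin r) k ⧸ I))
    (hA : ∀ j, A j =
      (homogeneousSubmodule (Fin r) k j).map (Ideal.Quotient.mkₐ k I).toLinearMap)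
    (h : ℕ → ℕ) (hh : ∀ j, h j = Module.finrank k (A j)) :
    FiniteDimensional k (MvPolynomial (Fin r) k ⧸ I) ∧
    (∃ socle : Submodule k (MvPolynomial (Fin r) k ⧸ I),
      (∀ a, a ∈ socle ↔ ∀ i : Fin r, Ideal.Quotient.mk I (X i) * a = 0) ∧
      Module.finrank k socle = 2 ∧ ∀ a ∈ socle, a ∈ A (2 * r)) ∧
    (∀ j, j < r → h j ≤ h (j + 1)) ∧
    (∀ j, r ≤ j → j < 2 * r → h (j + 1) ≤ h j) ∧
    h (2 * r) = 2 ∧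
    (∀ j, 1 ≤ j → j ≤ r → h (r - j) ≤ h (r + j) ∧ h (r + j) ≤ h (r - j + 1)) ∧
    (∀ L ∈ homogeneousSubmodule (Fin r) k 1,
      ¬ ∀ b ∈ A (r + 1), ∃ a ∈ A r, Ideal.Quotient.mk I L * a = b) := by
  obtain ⟨n, rfl⟩ := Nat.exists_eq_add_of_le' (show 2 ≤ r by omega)
  have hn : 2 ≤ n := by omega
  have hI' : ∀ p, p ∈ I ↔ ∀ m, WLPAux.Std m → coeff m p = 0 := WLPAux.mem_I I hI
  have hH : ∀ j, (h j : ℤ) = WLPAux.H n ((j : ℤ) - (n + 2)) := by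
    intro j
    rw [hh, hA, WLPAux.finrank_A I hI', WLPAux.card_std]
  have htop : h (2 * (n + 2)) = 2 := by
    zify
    rw [hH]
    push_cast
    rw [show 2 * ((n : ℤ) + 2) - (n + 2) = n + 2 by ring, WLPAux.H_top]
  refine ⟨WLPAux.finite_quot I hI', ⟨A (2 * (n + 2)), ?_, ?_, fun a ha => ha⟩, ?_, ?_, htop,
    ?_, ?_⟩
  · intro a
    rw [hA]
    exact WLPAux.socle_iff I hI' a
  · rw [← hh, htop]
  · intro j hj
    zify
    rw [hH, hH]
    have := WLPAux.H_up n ((j : ℤ) - (n + 2)) (by omega)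
    rwa [show (j : ℤ) - (n + 2) + 1 = ((j + 1 : ℕ) : ℤ) - (n + 2) by push_cast; ring] at this
  · intro j hj _
    zify
    rw [hH, hH]
    have := WLPAux.H_down n (by omega) ((j : ℤ) - (n + 2)) (by omega)
    rwa [show (j : ℤ) - (n + 2) + 1 = ((j + 1 : ℕ) : ℤ) - (n + 2) by push_cast; ring] at this
  · intro j hj1 hj2
    have h1 := hH (n + 2 - j)
    have h2 := hH (n + 2 + j)
    have h3 := hH (n + 2 - j + 1)
    rw [show ((n + 2 - j : ℕ) : ℤ) - (n + 2) = -j by omega] at h1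
    rw [show ((n + 2 + j : ℕ) : ℤ) - (n + 2) = j by omega] at h2
    rw [show ((n + 2 - j + 1 : ℕ) : ℤ) - (n + 2) = -j + 1 by omega] at h3
    have ha := WLPAux.H_a n j (by omega)
    have hb := WLPAux.H_b n (by omega) j (by omega)
    constructor <;> omega
  · intro L hL hsurj
    obtain ⟨b, hb, hne⟩ := WLPAux.not_surj hn I hI' L hL
    rw [← hA] at hb
    obtain ⟨a, _, hab⟩ := hsurj b hb
    exact hne a hab
end
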